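/- arXiv:0804.1503 — 5 statements merged into one kernel-verified Lean document; each statement's English description precedes it below -/
import Mathlib

section
/- Let n ≥ 3, d = 3n+1, K = 2n+3, let Φ be a Clebsch covariant of degree d, let g ∈ V(d), and let f(c) be as in the context. Write Φ(f(c)+g, f(c)+g, f(c)+g, f(c)+g) = Σ_{i=0}^d Q_i c^i and Φ(−(c x₁+y)^d+g, −(c x₁+y)^d+g, −(c x₁+y)^d+g, −(c x₁+y)^d+g) = Σ_{i=0}^d Q'_i c^i with Q_i, Q'_i ∈ V(4). Then Q_i = Q'_i for all i ≥ K; in particular, for i ≥ K the quartics Q_i do not depend on the choice of b₁,…,b_K. -/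
open MvPolynomial

noncomputable section

/-- The polynomial ring ℂ[x₁,x₂,x₃]. -/
abbrev MvP : Type := MvPolynomial (Fin 3) ℂ

/-- The linear form a₁x₁+a₂x₂+a₃x₃ with coefficient vector a. -/
def lin (a : Fin 3 → ℂ) : MvP := ∑ i, C (a i) * X i

lemma lin_hom (a : Fin 3 → ℂ) : (lin a).IsHomogeneous 1 := by
  unfold lin
  apply IsHomogeneous.sum
  intro i _
  simpa using (isHomogeneous_C (Fin 3) (a i)).mul (isHomogeneous_X ℂ i)

/-- V(k): the space of homogeneous polynomials of degree k in ℂ[x₁,x₂,x₃]. -/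
def V (k : ℕ) : Submodule ℂ MvP := homogeneousSubmodule (Fin 3) ℂ k

/-- l^d as an element of V(d), where l is the linear form with coefficient vector a. -/
def powV (d : ℕ) (a : Fin 3 → ℂ) : V d :=
  ⟨lin a ^ d, by rw [V, mem_homogeneousSubmodule]; simpa using (lin_hom a).pow d⟩

/-- The bracket (l₁l₂l₃) = det(vec l₁, vec l₂, vec l₃). -/
def br (a b c : Fin 3 → ℂ) : ℂ := Matrix.det (Matrix.of ![a, b, c])

/-- I(l₁,l₂,l₃,l₄) = (l₁l₂l₃)(l₁l₂l₄)(l₁l₃l₄)(l₂l₃l₄). -/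
def Icov (a b c d : Fin 3 → ℂ) : ℂ := br a b c * br a b d * br a c d * br b c d

/-- l₁l₂l₃l₄ as an element of V(4). -/
def prod4 (a b c d : Fin 3 → ℂ) : V 4 :=
  ⟨lin a * lin b * lin c * lin d, by
    rw [V, mem_homogeneousSubmodule]
    simpa using (((lin_hom a).mul (lin_hom b)).mul (lin_hom c)).mul (lin_hom d)⟩

/-- l₁²l₂²l₃²l₄² as an element of V(8). -/
def prod4sq (a b c d : Fin 3 → ℂ) : V 8 :=
  ⟨lin a ^ 2 * lin b ^ 2 * lin c ^ 2 * lin d ^ 2, by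
    rw [V, mem_homogeneousSubmodule]
    simpa using ((((lin_hom a).pow 2).mul ((lin_hom b).pow 2)).mul ((lin_hom c).pow 2)).mul
      ((lin_hom d).pow 2)⟩

/-- Φ is a Clebsch covariant of degree d = 3n+1: a symmetric quadrilinear map
V(d)⁴ → V(4) with Φ(l₁^d,l₂^d,l₃^d,l₄^d) = I(l₁,l₂,l₃,l₄)^n · l₁l₂l₃l₄. -/
def IsClebschS (n : ℕ) (Φ : MultilinearMap ℂ (fun _ : Fin 4 => V (3*n+1)) (V 4)) : Prop :=
  (∀ (v : Fin 4 → V (3*n+1)) (σ : Equiv.Perm (Fin 4)), Φ (v ∘ σ) = Φ v) ∧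
  (∀ a b c d : Fin 3 → ℂ,
    Φ ![powV (3*n+1) a, powV (3*n+1) b, powV (3*n+1) c, powV (3*n+1) d]
      = (Icov a b c d) ^ n • prod4 a b c d)

/-- Ψ is a Clebsch covariant of degree d = 3n+2: a symmetric quadrilinear map
V(d)⁴ → V(8) with Ψ(l₁^d,l₂^d,l₃^d,l₄^d) = I(l₁,l₂,l₃,l₄)^n · l₁²l₂²l₃²l₄². -/
def IsClebschT (n : ℕ) (Ψ : MultilinearMap ℂ (fun _ : Fin 4 => V (3*n+2)) (V 8)) : Prop :=
  (∀ (v : Fin 4 → V (3*n+2)) (σ : Equiv.Perm (Fin 4)), Ψ (v ∘ σ) = Ψ v) ∧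
  (∀ a b c d : Fin 3 → ℂ,
    Ψ ![powV (3*n+2) a, powV (3*n+2) b, powV (3*n+2) c, powV (3*n+2) d]
      = (Icov a b c d) ^ n • prod4sq a b c d)

/-- Membership in L_S = x₁^{2n+3}·V(n−2): a homogeneous form of degree 3n+1 lies in L_S
iff it is divisible by x₁^{2n+3}. -/
def memLS (n : ℕ) (h : V (3*n+1)) : Prop := (X 0 : MvP) ^ (2*n+3) ∣ (h : MvP)

/-- Membership in L_T = x₁^{2n+5}·V(n−3): a homogeneous form of degree 3n+2 lies in L_T
iff it is divisible by x₁^{2n+5}. -/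
def memLT (n : ℕ) (h : V (3*n+2)) : Prop := (X 0 : MvP) ^ (2*n+5) ∣ (h : MvP)

/-- The Lagrange interpolation polynomial p_i^b of degree K−1 evaluated at c. -/
def interp {K : ℕ} (b : Fin K → ℂ) (i : Fin K) (c : ℂ) : ℂ :=
  ∏ j ∈ Finset.univ.erase i, (c - b j) / (b i - b j)

/-- f(c) = Σᵢ p_i^b(c)·l_i^d − (cx₁+y)^d where y = λx₂+μx₃ and l_i = b_i x₁ + y. -/
def fc {K : ℕ} (d : ℕ) (b : Fin K → ℂ) (lam mu c : ℂ) : MvP :=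
  ∑ i, C (interp b i c) * lin ![b i, lam, mu] ^ d - lin ![c, lam, mu] ^ d

/-- f(c) as an element of V(d). -/
def fcV {K : ℕ} (d : ℕ) (b : Fin K → ℂ) (lam mu c : ℂ) : V d :=
  ∑ i, interp b i c • powV d ![b i, lam, mu] - powV d ![c, lam, mu]

/-- The bracket (l₁l₂l₃) over an arbitrary commutative ring. -/
def brR {R : Type*} [CommRing R] (a b c : Fin 3 → R) : R := Matrix.det (Matrix.of ![a, b, c])

/-- I(l₁,l₂,l₃,l₄) over an arbitrary commutative ring. -/
def IcovR {R : Type*} [CommRing R] (a b c d : Fin 3 → R) : R :=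
  brR a b c * brR a b d * brR a c d * brR b c d

/-- The binomial coefficient polynomial X(X−1)⋯(X−m+1)/m! over ℂ. -/
def binomPoly (m : ℕ) : Polynomial ℂ :=
  Polynomial.C ((m.factorial : ℂ))⁻¹ * ∏ i ∈ Finset.range m, (Polynomial.X - Polynomial.C (i : ℂ))

/-- The mod-p binomial coefficient polynomial X(X−1)⋯(X−m+1)/m!. -/
def binomPolyZMod (p m : ℕ) : Polynomial (ZMod p) :=
  Polynomial.C ((m.factorial : ZMod p))⁻¹ *
    ∏ i ∈ Finset.range m, (Polynomial.X - Polynomial.C (i : ZMod p))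

/-- c·x₁ + λx₂ + μx₃ as an element of (ℂ[x₁,x₂,x₃])[c]. -/
def cLin (lam mu : ℂ) : Polynomial MvP :=
  Polynomial.X * Polynomial.C (X 0) + Polynomial.C (C lam * X 1 + C mu * X 2)

/-- G_n = −24 Σ_{i<k<p} I(cx₁+y, m_i, m_k, m_p)^n·(cx₁+y)·m_i m_k m_p ∈ ℂ[c,x₁,x₂,x₃],
viewed as a polynomial in c with coefficients in ℂ[x₁,x₂,x₃]. -/
def Gpoly {N : ℕ} (m : Fin N → Fin 3 → ℂ) (lam mu : ℂ) (n : ℕ) : Polynomial MvP :=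
  (-24 : Polynomial MvP) *
    ∑ i, ∑ k, ∑ p,
      if i < k ∧ k < p then
        Polynomial.map (MvPolynomial.C)
          ((IcovR ![Polynomial.X, Polynomial.C lam, Polynomial.C mu]
            (fun j => Polynomial.C (m i j)) (fun j => Polynomial.C (m k j))
            (fun j => Polynomial.C (m p j))) ^ n)
        * cLin lam mu * Polynomial.C (lin (m i) * lin (m k) * lin (m p))
      else 0

/-- The nine linear forms m₁,…,m₉ (coefficient vectors). -/
def ms : Fin 9 → Fin 3 → ℂ :=
  ![![1, 3, 9], ![-10, 1, 4], ![8, 4, 6],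
    ![1, 6, -10], ![4, -8, -10], ![-3, 7, -4],
    ![0, -3, 2], ![8, -4, -4], ![-10, 4, 6]]

lemma pow_span (d : ℕ) (T : V d →ₗ[ℂ] ℂ) (h : ∀ a, T (powV d a) = 0) : ∀ u, T u = 0 := by
  obtain ⟨S, hS⟩ := LinearMap.exists_extend T
  have hS' : ∀ u : V d, T u = S (u : MvP) := fun u => by rw [← hS]; rfl
  let e : (Fin 3 → ℕ) → (Fin 3 →₀ ℕ) := fun k => Finsupp.equivFunOnFinite.symm k
  have hprod : ∀ (a : Fin 3 → ℂ) (k : Fin 3 → ℕ),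
      (∏ i, (C (a i) * X i : MvP) ^ k i) = (∏ i, a i ^ k i) • monomial (e k) (1 : ℂ) := by
    intro a k
    rw [MvPolynomial.monomial_eq, Finsupp.prod_fintype _ _ (by simp)]
    simp only [mul_pow, Finset.prod_mul_distrib, smul_eq_C_mul, map_one, one_mul, map_prod, map_pow]
    rfl
  let P : MvP := ∑ k ∈ Finset.piAntidiag Finset.univ d,
    monomial (e k) ((Nat.multinomial Finset.univ k : ℂ) * S (monomial (e k) 1))
  have hP : P = 0 := by
    apply MvPolynomial.funext
    intro a
    have h1 := h a
    rw [hS'] at h1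
    simp only [powV, lin] at h1
    rw [Finset.sum_pow_eq_sum_piAntidiag, map_sum] at h1
    rw [map_zero, ← h1, map_sum]
    apply Finset.sum_congr rfl
    intro k _
    rw [hprod, ← nsmul_eq_mul (α := MvP), map_nsmul S, map_smul S, eval_monomial,
      Finsupp.prod_fintype _ _ (by simp)]
    simp only [nsmul_eq_mul, smul_eq_mul]
    have : ∀ i, e k i = k i := fun i => rfl
    simp only [this]
    ring
  have hm : ∀ k : Fin 3 → ℕ, ∑ i, k i = d → S (monomial (e k) 1) = 0 := by
    intro k hk
    have h2 : coeff (e k) P = 0 := by rw [hP, coeff_zero]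
    simp only [P, coeff_sum, coeff_monomial] at h2
    rw [Finset.sum_eq_single k] at h2
    · rw [if_pos rfl] at h2
      refine (mul_eq_zero.mp h2).resolve_left ?_
      exact_mod_cast (Nat.multinomial_pos _ _).ne'
    · intro k' _ hk'
      rw [if_neg]
      intro he
      exact hk' (Finsupp.equivFunOnFinite.symm.injective he)
    · intro hk'
      exact absurd (by simp [hk]) hk'
  intro u
  rw [hS', (u : MvP).as_sum, map_sum]
  apply Finset.sum_eq_zero
  intro m hmm
  have hu : (u : MvP).IsHomogeneous d := (mem_homogeneousSubmodule _ _).1 u.2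
  have hd := hu (mem_support_iff.1 hmm)
  have : (monomial m (coeff m (u : MvP)) : MvP) = coeff m (u : MvP) • monomial (e m) 1 := by
    have hem : e m = m := Finsupp.equivFunOnFinite.symm_apply_apply m
    rw [smul_monomial, smul_eq_mul, mul_one, hem]
  rw [this, map_smul, hm, smul_zero]
  rw [← hd, Finsupp.weight_apply, Finsupp.sum_fintype _ _ (by simp)]
  simp

lemma evalV (u v : V 4) (h : ∀ z, eval z (u : MvP) = eval z (v : MvP)) : u = v :=
  Subtype.ext (MvPolynomial.funext h)

/-- evaluation as a linear functional -/
def evL (z : Fin 3 → ℂ) : V 4 →ₗ[ℂ] ℂ := (aeval z : MvP →ₐ[ℂ] ℂ).toLinearMap ∘ₗ (V 4).subtype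

lemma evL_apply (z : Fin 3 → ℂ) (u : V 4) : evL z u = eval z (u : MvP) := by
  simp [evL, aeval_eq_eval]

lemma pow_expand (d : ℕ) (lam mu : ℂ) : ∃ e : ℕ → V d, ∀ s : ℂ,
    powV d ![s, lam, mu] = ∑ j ∈ Finset.range (d+1), s ^ j • e j := by
  refine ⟨fun j => ⟨homogeneousComponent d
    ((X 0 : MvP)^j * (C lam * X 1 + C mu * X 2)^(d-j) * (d.choose j : MvP)), ?_⟩, ?_⟩
  · rw [V, mem_homogeneousSubmodule]
    exact homogeneousComponent_isHomogeneous _ _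
  intro s
  apply Subtype.ext
  have h : (powV d ![s, lam, mu] : MvP) ∈ homogeneousSubmodule (Fin 3) ℂ d := (powV d ![s, lam, mu]).2
  have h2 := homogeneousComponent_of_mem (m := d) (n := d) h
  rw [if_pos rfl] at h2
  rw [← h2]
  simp only [Submodule.coe_sum, Submodule.coe_smul, ← map_smul, ← map_sum]
  congr 1
  have : (powV d ![s, lam, mu] : MvP) = (C s * X 0 + (C lam * X 1 + C mu * X 2)) ^ d := by
    simp [powV, lin, Fin.sum_univ_three, add_assoc]
  rw [this, add_pow]
  apply Finset.sum_congr rfl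
  intro j _
  rw [smul_eq_C_mul, map_pow]
  ring

lemma interp_eq {K : ℕ} (b : Fin K → ℂ) (i : Fin K) (c : ℂ) :
    interp b i c = (Lagrange.basis Finset.univ b i).eval c := by
  simp only [interp, Lagrange.basis, Polynomial.eval_prod, Lagrange.basisDivisor]
  apply Finset.prod_congr rfl
  intro j _
  simp
  ring

lemma interp_pow {K : ℕ} (b : Fin K → ℂ) (hb : Function.Injective b) (j : ℕ) (hj : j < K) (c : ℂ) :
    ∑ i, interp b i c * b i ^ j = c ^ j := by
  have h := Lagrange.eq_interpolate (s := Finset.univ) (v := b)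
    (f := (Polynomial.X ^ j : Polynomial ℂ)) hb.injOn (by simp; exact_mod_cast hj)
  have h2 := congrArg (Polynomial.eval c) h
  simp only [Lagrange.interpolate_apply, Polynomial.eval_finsetSum, Polynomial.eval_mul,
    Polynomial.eval_C, Polynomial.eval_pow, Polynomial.eval_X, ← interp_eq] at h2
  rw [h2]
  exact Finset.sum_congr rfl fun i _ => mul_comm _ _

lemma fcV_expand {K : ℕ} (d : ℕ) (b : Fin K → ℂ) (hb : Function.Injective b) (lam mu c : ℂ)
    (e : ℕ → V d) (he : ∀ s : ℂ, powV d ![s, lam, mu] = ∑ j ∈ Finset.range (d+1), s ^ j • e j) :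
    ∃ w : ℕ → ℂ, (∀ j, j < K → w j = 0) ∧
      fcV d b lam mu c = ∑ j ∈ Finset.range (d+1), w j • e j := by
  refine ⟨fun j => ∑ i, interp b i c * b i ^ j - c ^ j, fun j hj => ?_, ?_⟩
  · simp only [interp_pow b hb j hj c, sub_self]
  · simp only [fcV, he, Finset.smul_sum, smul_smul]
    rw [Finset.sum_comm, ← Finset.sum_sub_distrib]
    refine Finset.sum_congr rfl fun j _ => ?_
    rw [← Finset.sum_smul]
    exact (sub_smul _ _ _).symm

lemma totdeg1 (α β γ : ℂ) :
    (C α * X 0 + C β * X 1 + C γ : MvPolynomial (Fin 2) ℂ).totalDegree ≤ 1 := by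
  refine (totalDegree_add _ _).trans (max_le ((totalDegree_add _ _).trans (max_le ?_ ?_)) ?_)
  · refine (totalDegree_mul _ _).trans ?_
    simp
  · refine (totalDegree_mul _ _).trans ?_
    simp
  · simp

section quad
variable {n : ℕ} {Φ : MultilinearMap ℂ (fun _ : Fin 4 => V (3*n+1)) (V 4)}

/-- first-slot linear map -/
def T1 (Φ : MultilinearMap ℂ (fun _ : Fin 4 => V (3*n+1)) (V 4)) (v w x : V (3*n+1)) :
    V (3*n+1) →ₗ[ℂ] V 4 where
  toFun u := Φ ![u, v, w, x]
  map_add' u u' := Φ.cons_add ![v, w, x] u u'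
  map_smul' c u := Φ.cons_smul ![v, w, x] c u

lemma T1_apply (u v w x : V (3*n+1)) : T1 Φ v w x u = Φ ![u, v, w, x] := rfl

lemma sw1 (hΦ : IsClebschS n Φ) (u v w x : V (3*n+1)) : Φ ![u, v, w, x] = Φ ![v, u, w, x] := by
  rw [← hΦ.1 _ (Equiv.swap 0 1)]
  congr 1
  funext i
  fin_cases i <;> rfl

lemma sw2 (hΦ : IsClebschS n Φ) (u v w x : V (3*n+1)) : Φ ![u, v, w, x] = Φ ![w, v, u, x] := by
  rw [← hΦ.1 _ (Equiv.swap 0 2)]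
  congr 1
  funext i
  fin_cases i <;> rfl

lemma sw3 (hΦ : IsClebschS n Φ) (u v w x : V (3*n+1)) : Φ ![u, v, w, x] = Φ ![x, v, w, u] := by
  rw [← hΦ.1 _ (Equiv.swap 0 3)]
  congr 1
  funext i
  fin_cases i <;> rfl

lemma ad1 (u u' v w x : V (3*n+1)) :
    Φ ![u + u', v, w, x] = Φ ![u, v, w, x] + Φ ![u', v, w, x] := (T1 Φ v w x).map_add u u'

lemma four (hΦ : IsClebschS n Φ) (f g : V (3*n+1)) (h : ∀ u v, Φ ![f, f, u, v] = 0) :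
    Φ ![f + g, f + g, f + g, f + g] = Φ ![g, g, g, g] + (4 : ℂ) • Φ ![f, g, g, g] := by
  have ad2 : ∀ v u u' w x : V (3*n+1), Φ ![v, u + u', w, x] = Φ ![v, u, w, x] + Φ ![v, u', w, x] := by
    intro v u u' w x
    rw [sw1 hΦ, ad1, sw1 hΦ u, sw1 hΦ u']
  have ad3 : ∀ w v u u' x : V (3*n+1), Φ ![w, v, u + u', x] = Φ ![w, v, u, x] + Φ ![w, v, u', x] := by
    intro w v u u' x
    rw [sw2 hΦ, ad1, sw2 hΦ u, sw2 hΦ u']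
  have ad4 : ∀ x v w u u' : V (3*n+1), Φ ![x, v, w, u + u'] = Φ ![x, v, w, u] + Φ ![x, v, w, u'] := by
    intro x v w u u'
    rw [sw3 hΦ, ad1, sw3 hΦ u, sw3 hΦ u']
  have h2 : ∀ u v, Φ ![f, u, f, v] = 0 := fun u v => by
    rw [sw1 hΦ, sw2 hΦ, h]
  have h3 : ∀ u v, Φ ![f, u, v, f] = 0 := fun u v => by
    rw [sw1 hΦ, sw3 hΦ, h]
  have h4 : ∀ u v, Φ ![u, f, f, v] = 0 := fun u v => by
    rw [sw1 hΦ, h2]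
  have h5 : ∀ u v, Φ ![u, f, v, f] = 0 := fun u v => by
    rw [sw1 hΦ, h3]
  have h6 : ∀ u v, Φ ![u, v, f, f] = 0 := fun u v => by
    rw [sw2 hΦ, h3]
  have k1 : Φ ![g, f, g, g] = Φ ![f, g, g, g] := sw1 hΦ _ _ _ _
  have k2 : Φ ![g, g, f, g] = Φ ![f, g, g, g] := sw2 hΦ _ _ _ _
  have k3 : Φ ![g, g, g, f] = Φ ![f, g, g, g] := sw3 hΦ _ _ _ _
  simp only [ad1, ad2, ad3, ad4, h, h2, h3, h4, h5, h6, k1, k2, k3]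
  module

lemma ext34 (hΦ : IsClebschS n Φ) (f f' : V (3*n+1))
    (h : ∀ a a', Φ ![f, f', powV (3*n+1) a, powV (3*n+1) a'] = 0) (u v : V (3*n+1)) :
    Φ ![f, f', u, v] = 0 := by
  have step : ∀ a v, Φ ![f, f', powV (3*n+1) a, v] = 0 := by
    intro a v
    apply evalV
    intro z
    have := pow_span _ (evL z ∘ₗ T1 Φ f' (powV (3*n+1) a) f) (fun a' => by
      rw [LinearMap.comp_apply, T1_apply, sw3 hΦ, h, map_zero]) v
    rw [LinearMap.comp_apply, T1_apply, sw3 hΦ, evL_apply] at this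
    simpa using this
  apply evalV
  intro z
  have := pow_span _ (evL z ∘ₗ T1 Φ f' f v) (fun a' => by
      rw [LinearMap.comp_apply, T1_apply, sw2 hΦ, step, map_zero]) u
  rw [LinearMap.comp_apply, T1_apply, sw2 hΦ, evL_apply] at this
  simpa using this

lemma LL (hn : 3 ≤ n) (hΦ : IsClebschS n Φ) (a : Fin 3 → ℂ) (u v : V (3*n+1)) :
    Φ ![powV (3*n+1) a, powV (3*n+1) a, u, v] = 0 := by
  apply ext34 hΦ
  intro b c
  rw [hΦ.2]
  have : br a a b = 0 := by
    simp [br, Matrix.det_fin_three]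
    ring
  rw [Icov, this]
  simp [show n ≠ 0 by omega]

lemma ee (hΦ : IsClebschS n Φ) (lam mu : ℂ) (e : ℕ → V (3*n+1))
    (he : ∀ s : ℂ, powV (3*n+1) ![s, lam, mu] = ∑ j ∈ Finset.range (3*n+1+1), s ^ j • e j)
    (a a' : Fin 3 → ℂ) (j k : ℕ) (hj : j < 3*n+1+1) (hk : k < 3*n+1+1) (hjk : 4*n+2 < j+k) :
    Φ ![e j, e k, powV (3*n+1) a, powV (3*n+1) a'] = 0 := by
  apply evalV
  intro z
  set p := powV (3*n+1) a
  set q := powV (3*n+1) a'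
  let B : ℕ → ℕ → ℂ := fun j k => evL z (Φ ![e j, e k, p, q])
  have hB : ∀ s t : ℂ, evL z (Φ ![powV (3*n+1) ![s, lam, mu], powV (3*n+1) ![t, lam, mu], p, q])
      = ∑ j ∈ Finset.range (3*n+1+1), ∑ k ∈ Finset.range (3*n+1+1), s ^ j * t ^ k * B j k := by
    intro s t
    rw [he s, ← T1_apply, map_sum, map_sum]
    apply Finset.sum_congr rfl
    intro j _
    rw [map_smul, T1_apply, sw1 hΦ, he t, ← T1_apply, map_sum, Finset.smul_sum, map_sum]
    apply Finset.sum_congr rfl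
    intro k _
    rw [map_smul, map_smul, T1_apply, sw1 hΦ, map_smul]
    simp only [B, smul_eq_mul]
    ring
  let m : ℕ → ℕ → (Fin 2 →₀ ℕ) := fun j k => Finsupp.single 0 j + Finsupp.single 1 k
  let P1 : MvPolynomial (Fin 2) ℂ := ∑ j ∈ Finset.range (3*n+1+1), ∑ k ∈ Finset.range (3*n+1+1),
    monomial (m j k) (B j k)
  let L : ℂ → ℂ → ℂ → MvPolynomial (Fin 2) ℂ := fun α β γ => C α * X 0 + C β * X 1 + C γ
  have hL : ∀ α β γ, (L α β γ).totalDegree ≤ 1 := totdeg1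
  have hLe : ∀ α β γ (s : Fin 2 → ℂ), eval s (L α β γ) = α * s 0 + β * s 1 + γ := by
    intro α β γ s
    simp [L]
  let D : (Fin 3 → ℂ) → ℂ := fun a => lam * a 2 - mu * a 1
  let α := a 1 * a' 2 - a 2 * a' 1
  let γ := -lam * (a 0 * a' 2 - a 2 * a' 0) + mu * (a 0 * a' 1 - a 1 * a' 0)
  let y := lam * z 1 + mu * z 2
  let P2 : MvPolynomial (Fin 2) ℂ :=
    (L (D a) (-D a) 0 * L (D a') (-D a') 0 * L α 0 γ * L 0 α γ) ^ n *
      (L (z 0) 0 y * L 0 (z 0) y * C (eval z (lin a) * eval z (lin a')))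
  have hP : P1 = P2 := by
    apply MvPolynomial.funext
    intro s
    have h1 : eval s P1 = evL z (Φ ![powV (3*n+1) ![s 0, lam, mu], powV (3*n+1) ![s 1, lam, mu], p, q]) := by
      rw [hB]
      simp only [P1, map_sum]
      refine Finset.sum_congr rfl fun j _ => Finset.sum_congr rfl fun k _ => ?_
      rw [eval_monomial, Finsupp.prod_fintype _ _ (by simp)]
      simp [m]
      ring
    rw [h1, hΦ.2, map_smul, evL_apply]
    simp only [P2, map_mul, map_pow, hLe, eval_C, smul_eq_mul, prod4]
    congr 1
    · congr 1
      simp only [Icov, br, Matrix.det_fin_three]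
      simp [D, α, γ]
      ring
    · simp [lin, Fin.sum_univ_three, y]
      ring
  have hdeg : P2.totalDegree ≤ 4*n+2 := by
    refine (totalDegree_mul _ _).trans ?_
    have t1 : (L (D a) (-D a) 0 * L (D a') (-D a') 0 * L α 0 γ * L 0 α γ).totalDegree ≤ 4 := by
      have x1 := totalDegree_mul (L (D a) (-D a) 0 * L (D a') (-D a') 0 * L α 0 γ) (L 0 α γ)
      have x2 := totalDegree_mul (L (D a) (-D a) 0 * L (D a') (-D a') 0) (L α 0 γ)
      have x3 := totalDegree_mul (L (D a) (-D a) 0) (L (D a') (-D a') 0)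
      have y1 := hL (D a) (-D a) 0
      have y2 := hL (D a') (-D a') 0
      have y3 := hL α 0 γ
      have y4 := hL 0 α γ
      omega
    have t2 := (totalDegree_pow (L (D a) (-D a) 0 * L (D a') (-D a') 0 * L α 0 γ * L 0 α γ) n).trans
      (Nat.mul_le_mul_left n t1)
    have x1 := totalDegree_mul (L (z 0) 0 y * L 0 (z 0) y) (C (eval z (lin a) * eval z (lin a')))
    have x2 := totalDegree_mul (L (z 0) 0 y) (L 0 (z 0) y)
    have y1 := hL (z 0) 0 y
    have y2 := hL 0 (z 0) y
    rw [totalDegree_C] at x1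
    omega
  have hc : coeff (m j k) P2 = 0 := by
    apply coeff_eq_zero_of_totalDegree_lt
    refine lt_of_le_of_lt hdeg (lt_of_lt_of_eq hjk ?_)
    change _ = (m j k).sum fun _ x => x
    rw [Finsupp.sum_fintype _ _ (by simp)]
    simp [m]
  have hm : ∀ j' k', m j' k' = m j k ↔ j' = j ∧ k' = k := by
    intro j' k'
    constructor
    · intro h
      have h0 := DFunLike.congr_fun h 0
      have h1 := DFunLike.congr_fun h 1
      simp [m] at h0 h1
      exact ⟨h0, h1⟩
    · rintro ⟨rfl, rfl⟩
      rfl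
  rw [← hP] at hc
  simp only [P1, coeff_sum, coeff_monomial, hm] at hc
  rw [Finset.sum_eq_single j, Finset.sum_eq_single k] at hc
  · rw [if_pos ⟨rfl, rfl⟩] at hc
    simpa [B, evL_apply] using hc
  · intro k' _ hk'
    rw [if_neg (fun h => hk' h.2)]
  · intro h
    exact absurd (Finset.mem_range.2 hk) h
  · intro j' _ hj'
    exact Finset.sum_eq_zero fun k' _ => if_neg (fun h => hj' h.1)
  · intro h
    exact absurd (Finset.mem_range.2 hj) h

lemma ff (hΦ : IsClebschS n Φ) (b : Fin (2*n+3) → ℂ) (hb : Function.Injective b)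
    (lam mu c : ℂ) (u v : V (3*n+1)) :
    Φ ![fcV (3*n+1) b lam mu c, fcV (3*n+1) b lam mu c, u, v] = 0 := by
  apply ext34 hΦ
  intro a a'
  obtain ⟨e, he⟩ := pow_expand (3*n+1) lam mu
  obtain ⟨w, hw, hf⟩ := fcV_expand (3*n+1) b hb lam mu c e he
  rw [hf, ← T1_apply, map_sum]
  apply Finset.sum_eq_zero
  intro j hj
  rw [map_smul]
  by_cases hjK : j < 2*n+3
  · rw [hw j hjK, zero_smul]
  rw [T1_apply, sw1 hΦ, ← T1_apply, map_sum, Finset.sum_eq_zero, smul_zero]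
  intro k hk
  rw [map_smul]
  by_cases hkK : k < 2*n+3
  · rw [hw k hkK, zero_smul]
  rw [T1_apply, ee hΦ lam mu e he a a' k j (Finset.mem_range.1 hk) (Finset.mem_range.1 hj) (by omega),
    smul_zero]

end quad

theorem stmt12 (n : ℕ) (hn : 3 ≤ n)
    (Φ : MultilinearMap ℂ (fun _ : Fin 4 => V (3*n+1)) (V 4)) (hΦ : IsClebschS n Φ)
    (g : V (3*n+1))
    (b : Fin (2*n+3) → ℂ) (hb : Function.Injective b)
    (lam mu : ℂ) (hlm : (lam, mu) ≠ (0, 0))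
    (Q Q' : Fin (3*n+2) → V 4)
    (hQ : ∀ c : ℂ,
      Φ ![fcV (3*n+1) b lam mu c + g, fcV (3*n+1) b lam mu c + g,
          fcV (3*n+1) b lam mu c + g, fcV (3*n+1) b lam mu c + g]
        = ∑ i : Fin (3*n+2), c ^ (i : ℕ) • Q i)
    (hQ' : ∀ c : ℂ,
      Φ ![g - powV (3*n+1) ![c, lam, mu], g - powV (3*n+1) ![c, lam, mu],
          g - powV (3*n+1) ![c, lam, mu], g - powV (3*n+1) ![c, lam, mu]]
        = ∑ i : Fin (3*n+2), c ^ (i : ℕ) • Q' i) :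
    ∀ i : Fin (3*n+2), 2*n+3 ≤ (i : ℕ) → Q i = Q' i := by
  intro i hi
  let f : ℂ → V (3*n+1) := fun c => fcV (3*n+1) b lam mu c
  let L : ℂ → V (3*n+1) := fun c => powV (3*n+1) ![c, lam, mu]
  have key : ∀ c : ℂ, ∑ i : Fin (3*n+2), c ^ (i : ℕ) • (Q i - Q' i)
      = ∑ j, interp b j c • ((4 : ℂ) • T1 Φ g g g (powV (3*n+1) ![b j, lam, mu])) := by
    intro c
    have h1 := four hΦ (f c) g (ff hΦ b hb lam mu c)
    have h2 := four hΦ (-L c) g (fun u v => by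
      rw [← T1_apply, map_neg, T1_apply, sw1 hΦ, ← T1_apply, map_neg, T1_apply, LL hn hΦ]
      simp)
    rw [hQ c] at h1
    rw [neg_add_eq_sub, hQ' c] at h2
    simp only [smul_sub, Finset.sum_sub_distrib]
    rw [h1, h2, add_sub_add_left_eq_sub]
    refine (smul_sub (4 : ℂ) (T1 Φ g g g (f c)) (T1 Φ g g g (-L c))).symm.trans ?_
    rw [← map_sub]
    have : f c - -L c = ∑ j, interp b j c • powV (3*n+1) ![b j, lam, mu] := by
      simp [f, L, fcV]
    rw [this, map_sum, Finset.smul_sum]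
    refine Finset.sum_congr rfl fun j _ => ?_
    rw [map_smul, smul_comm]
  apply evalV
  intro z
  let r : Fin (2*n+3) → ℂ :=
    fun j => evL z ((4 : ℂ) • T1 Φ g g g (powV (3*n+1) ![b j, lam, mu]))
  have hpoly : (∑ i : Fin (3*n+2), Polynomial.monomial (i : ℕ) (evL z (Q i - Q' i)))
      = Lagrange.interpolate Finset.univ b r := by
    apply Polynomial.funext
    intro c
    have h := congrArg (evL z) (key c)
    simp only [map_sum, map_smul (evL z) (_ ^ _), map_smul (evL z) (interp _ _ _)] at h
    rw [Lagrange.interpolate_apply]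
    simp only [Polynomial.eval_finsetSum, Polynomial.eval_monomial, Polynomial.eval_mul,
      Polynomial.eval_C, ← interp_eq]
    simp only [smul_eq_mul] at h
    simp only [mul_comm _ (c ^ _), mul_comm (r _)]
    exact h
  have hdeg := Lagrange.degree_interpolate_lt (s := Finset.univ) (v := b) r hb.injOn
  have hcf := congrArg (fun p => Polynomial.coeff p (i : ℕ)) hpoly
  rw [Polynomial.coeff_eq_zero_of_degree_lt (p := Lagrange.interpolate Finset.univ b r)
    (lt_of_lt_of_le hdeg (by simp only [Finset.card_univ, Fintype.card_fin]; exact_mod_cast hi)),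
    Polynomial.finsetSum_coeff] at hcf
  simp only [Polynomial.coeff_monomial, Fin.val_inj] at hcf
  rw [Finset.sum_ite_eq' ] at hcf
  simp only [Finset.mem_univ, if_true, map_sub, evL_apply] at hcf
  exact sub_eq_zero.1 hcf
end
end

section
/- Let m₁, m₂, m₃ be linear forms in ℂ[x₁,x₂,x₃] and let y = λx₂+μx₃ with λ, μ ∈ ℂ. Then there exists ρ ∈ ℂ, independent of everything below, such that for every integer t ≥ 0 there is a polynomial P_t ∈ ℂ[X] with deg P_t ≤ t which is divisible in ℂ[X] by the binomial-coefficient polynomial X(X−1)⋯(X−⌊t/3⌋+1)/⌊t/3⌋!, such that for all integers n > t, the coefficient of c^{3n−t} in the one-variable polynomial I(c x₁ + y, m₁, m₂, m₃)^n ∈ ℂ[c] equals ρ^n · P_t(n). -/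
open MvPolynomial

noncomputable section

lemma binomPoly_eval (m n : ℕ) : (binomPoly m).eval (n : ℂ) = (n.choose m : ℂ) := by
  unfold binomPoly
  rw [Polynomial.eval_mul, Polynomial.eval_C, Polynomial.eval_prod]
  simp only [Polynomial.eval_sub, Polynomial.eval_X, Polynomial.eval_C]
  rw [← descPochhammer_eval_eq_prod_range, descPochhammer_eval_eq_descFactorial,
    Nat.descFactorial_eq_factorial_mul_choose]
  have : (m.factorial : ℂ) ≠ 0 := by exact_mod_cast m.factorial_ne_zero
  push_cast
  field_simp

lemma binomPoly_natDegree (m : ℕ) : (binomPoly m).natDegree ≤ m := by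
  unfold binomPoly
  refine (Polynomial.natDegree_C_mul_le _ _).trans ?_
  refine (Polynomial.natDegree_prod_le _ _).trans ?_
  simp only [Polynomial.natDegree_X_sub_C]
  simp

lemma binomPoly_dvd {m k : ℕ} (h : m ≤ k) : binomPoly m ∣ binomPoly k := by
  unfold binomPoly
  have hm : (m.factorial : ℂ)⁻¹ ≠ 0 := inv_ne_zero (by exact_mod_cast m.factorial_ne_zero)
  have hu : IsUnit (Polynomial.C ((m.factorial : ℂ))⁻¹) :=
    Polynomial.isUnit_C.2 hm.isUnit
  rw [hu.mul_left_dvd]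
  apply Dvd.dvd.mul_left
  exact Finset.prod_dvd_prod_of_subset _ _ _ (Finset.range_mono h)

lemma refl_coeff (u : ℂ) (n i : ℕ) :
    (Polynomial.reflect n ((Polynomial.X + Polynomial.C u) ^ n)).coeff i
      = u ^ i * (n.choose i : ℂ) := by
  rw [Polynomial.coeff_reflect]
  rcases le_or_gt i n with h | h
  · rw [Polynomial.revAt_le h, Polynomial.coeff_X_add_C_pow, Nat.sub_sub_self h,
      Nat.choose_symm h]
  · rw [Polynomial.revAt_eq_self_of_lt h, Polynomial.coeff_X_add_C_pow,
      Nat.choose_eq_zero_of_lt h]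
    simp

lemma key_coeff (u v w : ℂ) (n t : ℕ) (h : t < n) :
    ((((Polynomial.X + Polynomial.C u) * (Polynomial.X + Polynomial.C v)
      * (Polynomial.X + Polynomial.C w)) ^ n).coeff (3 * n - t) : ℂ)
      = ∑ p ∈ Finset.HasAntidiagonal.antidiagonal t, (∑ q ∈ Finset.HasAntidiagonal.antidiagonal p.1,
        (u ^ q.1 * (n.choose q.1 : ℂ)) * (v ^ q.2 * (n.choose q.2 : ℂ)))
          * (w ^ p.2 * (n.choose p.2 : ℂ)) := by
  have hd : ∀ u : ℂ, ((Polynomial.X + Polynomial.C u) ^ n).natDegree ≤ n := by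
    intro u
    rw [Polynomial.natDegree_pow, Polynomial.natDegree_X_add_C, mul_one]
  have e : 3 * n - t = Polynomial.revAt (n + n + n) t := by
    rw [Polynomial.revAt_le (by omega)]
    omega
  rw [e, ← Polynomial.coeff_reflect, mul_pow, mul_pow, Polynomial.reflect_mul _ _ _ (hd w),
    Polynomial.reflect_mul _ _ (hd u) (hd v), Polynomial.coeff_mul]
  · simp only [Polynomial.coeff_mul, refl_coeff]
  · exact Polynomial.natDegree_mul_le.trans (add_le_add (hd u) (hd v))

lemma main_lin (D a₁ b₁ a₂ b₂ a₃ b₃ : ℂ) :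
    ∃ ρ : ℂ, ∀ t : ℕ, ∃ P : Polynomial ℂ,
      P.natDegree ≤ t ∧ binomPoly (t / 3) ∣ P ∧
      ∀ n : ℕ, t < n →
        (((Polynomial.C a₁ * Polynomial.X + Polynomial.C b₁)
          * (Polynomial.C a₂ * Polynomial.X + Polynomial.C b₂)
          * (Polynomial.C a₃ * Polynomial.X + Polynomial.C b₃)
          * Polynomial.C D) ^ n).coeff (3*n - t)
          = ρ ^ n * P.eval (n : ℂ) := by
  refine ⟨a₁ * a₂ * a₃ * D, fun t => ?_⟩
  by_cases h0 : a₁ * a₂ * a₃ * D = 0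
  · refine ⟨0, by simp, dvd_zero _, fun n hn => ?_⟩
    rw [h0, Polynomial.eval_zero, mul_zero]
    apply Polynomial.coeff_eq_zero_of_natDegree_lt
    have hE : (Polynomial.C a₁ * Polynomial.X + Polynomial.C b₁)
          * (Polynomial.C a₂ * Polynomial.X + Polynomial.C b₂)
          * (Polynomial.C a₃ * Polynomial.X + Polynomial.C b₃)
          * Polynomial.C D =
          Polynomial.C ((a₁ * a₂ * b₃ + a₁ * b₂ * a₃ + b₁ * a₂ * a₃) * D) * Polynomial.X ^ 2
          + Polynomial.C ((a₁ * b₂ * b₃ + b₁ * b₂ * a₃ + b₁ * a₂ * b₃) * D) * Polynomial.X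
          + Polynomial.C (b₁ * b₂ * b₃ * D) := by
      have h1 : (Polynomial.C (a₁ * a₂ * a₃ * D) : Polynomial ℂ) = 0 := by rw [h0]; simp
      simp only [Polynomial.C_mul, Polynomial.C_add] at h1 ⊢
      linear_combination Polynomial.X ^ 3 * h1
    rw [hE]
    refine lt_of_le_of_lt Polynomial.natDegree_pow_le ?_
    refine lt_of_le_of_lt (Nat.mul_le_mul_left n Polynomial.natDegree_quadratic_le) ?_
    omega
  · have hD : D ≠ 0 := by rintro rfl; simp at h0
    have h1 : a₁ ≠ 0 := by rintro rfl; simp at h0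
    have h2 : a₂ ≠ 0 := by rintro rfl; simp at h0
    have h3 : a₃ ≠ 0 := by rintro rfl; simp at h0
    refine ⟨∑ p ∈ Finset.HasAntidiagonal.antidiagonal t, (∑ q ∈ Finset.HasAntidiagonal.antidiagonal p.1,
        (Polynomial.C ((b₁ / a₁) ^ q.1) * binomPoly q.1)
          * (Polynomial.C ((b₂ / a₂) ^ q.2) * binomPoly q.2))
          * (Polynomial.C ((b₃ / a₃) ^ p.2) * binomPoly p.2), ?_, ?_, ?_⟩
    · have hB : ∀ (c : ℂ) (m : ℕ), (Polynomial.C c * binomPoly m).natDegree ≤ m := fun c m =>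
        (Polynomial.natDegree_C_mul_le _ _).trans (binomPoly_natDegree m)
      refine Polynomial.natDegree_sum_le_of_forall_le _ _ fun p hp => ?_
      rw [Finset.HasAntidiagonal.mem_antidiagonal] at hp
      rw [← hp]
      refine Polynomial.natDegree_mul_le.trans (add_le_add ?_ (hB _ _))
      refine Polynomial.natDegree_sum_le_of_forall_le _ _ fun q hq => ?_
      rw [Finset.HasAntidiagonal.mem_antidiagonal] at hq
      rw [← hq]
      exact Polynomial.natDegree_mul_le.trans (add_le_add (hB _ _) (hB _ _))
    · refine Finset.dvd_sum fun p hp => ?_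
      rw [Finset.HasAntidiagonal.mem_antidiagonal] at hp
      by_cases hp2 : t / 3 ≤ p.2
      · exact ((binomPoly_dvd hp2).mul_left _).mul_left _
      apply Dvd.dvd.mul_right
      refine Finset.dvd_sum fun q hq => ?_
      rw [Finset.HasAntidiagonal.mem_antidiagonal] at hq
      by_cases hq2 : t / 3 ≤ q.2
      · exact ((binomPoly_dvd hq2).mul_left _).mul_left _
      · exact ((binomPoly_dvd (by omega)).mul_left _).mul_right _
    · intro n hn
      have hE : ((Polynomial.C a₁ * Polynomial.X + Polynomial.C b₁)
          * (Polynomial.C a₂ * Polynomial.X + Polynomial.C b₂)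
          * (Polynomial.C a₃ * Polynomial.X + Polynomial.C b₃)
          * Polynomial.C D) = Polynomial.C (a₁ * a₂ * a₃ * D) *
          ((Polynomial.X + Polynomial.C (b₁ / a₁)) * (Polynomial.X + Polynomial.C (b₂ / a₂))
      * (Polynomial.X + Polynomial.C (b₃ / a₃))) := by
        have e : ∀ a b : ℂ, a ≠ 0 → Polynomial.C a * Polynomial.X + Polynomial.C b
            = Polynomial.C a * (Polynomial.X + Polynomial.C (b / a)) := by
          intro a b ha
          rw [mul_add, ← Polynomial.C_mul, mul_div_cancel₀ _ ha]
        rw [e _ _ h1, e _ _ h2, e _ _ h3]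
        simp only [Polynomial.C_mul]
        ring
      rw [hE, mul_pow, ← Polynomial.C_pow, Polynomial.coeff_C_mul, key_coeff _ _ _ _ _ hn]
      simp only [Polynomial.eval_finset_sum, Polynomial.eval_mul, Polynomial.eval_C,
        binomPoly_eval]

theorem stmt13 (m₁ m₂ m₃ : Fin 3 → ℂ) (lam mu : ℂ) :
    ∃ ρ : ℂ, ∀ t : ℕ, ∃ P : Polynomial ℂ,
      P.natDegree ≤ t ∧ binomPoly (t / 3) ∣ P ∧
      ∀ n : ℕ, t < n →
        ((IcovR ![Polynomial.X, Polynomial.C lam, Polynomial.C mu]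
            (fun j => Polynomial.C (m₁ j)) (fun j => Polynomial.C (m₂ j))
            (fun j => Polynomial.C (m₃ j))) ^ n).coeff (3*n - t)
          = ρ ^ n * P.eval (n : ℂ) := by
  have hb : ∀ p q : Fin 3 → ℂ, brR ![Polynomial.X, Polynomial.C lam, Polynomial.C mu]
      (fun j => Polynomial.C (p j)) (fun j => Polynomial.C (q j))
      = Polynomial.C (p 1 * q 2 - p 2 * q 1) * Polynomial.X
        + Polynomial.C (- lam * (p 0 * q 2 - p 2 * q 0) + mu * (p 0 * q 1 - p 1 * q 0)) := by
    intro p q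
    simp only [brR, Matrix.det_fin_three, Polynomial.C_mul, Polynomial.C_add, Polynomial.C_sub,
      Polynomial.C_neg]
    simp
    ring
  have hD : brR (fun j => Polynomial.C (m₁ j)) (fun j => Polynomial.C (m₂ j))
      (fun j => Polynomial.C (m₃ j)) = Polynomial.C (brR m₁ m₂ m₃) := by
    simp [brR, Matrix.det_fin_three]
  unfold IcovR
  simp only [hb, hD]
  exact main_lin _ _ _ _ _ _ _
end
end

section
/- Let m₁, m₂, m₃ be linear forms in ℤ[x₁,x₂,x₃] and let y = λx₂+μx₃ with λ, μ ∈ ℤ, and let ℘ be a prime. Then I(c x₁ + y, m₁, m₂, m₃)^n ∈ ℤ[c], and there exists ρ ∈ 𝔽_℘ such that for every integer t with 0 ≤ t < ℘ there is a polynomial P_t ∈ 𝔽_℘[X] with deg P_t ≤ t, divisible in 𝔽_℘[X] by the mod-℘ reduction of X(X−1)⋯(X−⌊t/3⌋+1)/⌊t/3⌋! (note ⌊t/3⌋! is invertible mod ℘), such that for all integers n > t, the image in 𝔽_℘ of the coefficient of c^{3n−t} in I(c x₁ + y, m₁, m₂, m₃)^n equals ρ^n · P_t(n mod ℘). -/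
open MvPolynomial

noncomputable section

namespace Polynomial.S14

lemma br_lin (a b : Fin 3 → ℤ) (lam mu : ℤ) : ∃ u v : ℤ,
    brR ![Polynomial.X, Polynomial.C lam, Polynomial.C mu]
      (fun j => Polynomial.C (a j)) (fun j => Polynomial.C (b j))
      = Polynomial.C u * Polynomial.X + Polynomial.C v := by
  refine ⟨a 1 * b 2 - a 2 * b 1, -lam * (a 0 * b 2 - a 2 * b 0) + mu * (a 0 * b 1 - a 1 * b 0), ?_⟩
  simp [brR, Matrix.det_fin_three]
  ring

lemma br_const (a b c : Fin 3 → ℤ) : ∃ u : ℤ,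
    brR (fun j => Polynomial.C (a j))
      (fun j => Polynomial.C (b j)) (fun j => Polynomial.C (c j))
      = (Polynomial.C u : Polynomial ℤ) := by
  refine ⟨brR a b c, ?_⟩
  simp [brR, Matrix.det_fin_three]

lemma fact_ne {p : ℕ} [hp : Fact p.Prime] {m : ℕ} (hm : m < p) : (m.factorial : ZMod p) ≠ 0 := by
  rw [Ne, ZMod.natCast_eq_zero_iff, hp.out.dvd_factorial]
  omega

lemma binom_eval {p : ℕ} [hp : Fact p.Prime] {m n : ℕ} (hm : m < p) (hn : m ≤ n) :
    (binomPolyZMod p m).eval (n : ZMod p) = (n.choose m : ZMod p) := by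
  have h : ∏ i ∈ Finset.range m, ((n : ZMod p) - (i : ZMod p)) = (n.descFactorial m : ZMod p) := by
    rw [Nat.descFactorial_eq_prod_range, Nat.cast_prod]
    refine Finset.prod_congr rfl fun i hi => ?_
    have := Finset.mem_range.1 hi
    rw [Nat.cast_sub (by omega)]
  simp only [binomPolyZMod, eval_mul, eval_C, eval_prod, eval_sub, eval_X]
  rw [h, Nat.descFactorial_eq_factorial_mul_choose, Nat.cast_mul,
    inv_mul_cancel_left₀ (fact_ne hm)]

lemma binom_dvd {p : ℕ} [hp : Fact p.Prime] {m k : ℕ} (hm : m < p) (hk : m ≤ k) :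
    binomPolyZMod p m ∣ binomPolyZMod p k := by
  unfold binomPolyZMod
  have hu : IsUnit (Polynomial.C ((m.factorial : ZMod p))⁻¹) :=
    Polynomial.isUnit_C.2 (isUnit_iff_ne_zero.2 (inv_ne_zero (fact_ne hm)))
  rw [hu.mul_left_dvd]
  refine Dvd.dvd.mul_left ?_ _
  exact Finset.prod_dvd_prod_of_subset _ _ _ (Finset.range_mono hk)

lemma binom_deg (p : ℕ) [hp : Fact p.Prime] (m : ℕ) : (binomPolyZMod p m).natDegree ≤ m := by
  unfold binomPolyZMod
  refine (natDegree_C_mul_le _ _).trans ?_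
  refine (natDegree_prod_le _ _).trans ?_
  simp only [natDegree_X_sub_C]
  simp

lemma coeff_refl {R : Type*} [CommRing R] (b : R) {n i : ℕ} (hi : i ≤ n) :
    (reflect n ((X + C b) ^ n)).coeff i = b ^ i * (n.choose i : R) := by
  rw [coeff_reflect, revAt_le hi, coeff_X_add_C_pow, Nat.sub_sub_self hi, Nat.choose_symm hi]

lemma deg_pow {R : Type*} [CommRing R] (b : R) (n : ℕ) :
    ((X + C b) ^ n).natDegree ≤ n := by
  refine natDegree_pow_le.trans ?_
  have : (X + C b : Polynomial R).natDegree ≤ 1 := by compute_degree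
  nlinarith

lemma main_coeff {R : Type*} [CommRing R] (b₁ b₂ b₃ : R) {n t : ℕ} (ht : t < n) :
    (((X + C b₁) * (X + C b₂) * (X + C b₃)) ^ n).coeff (3 * n - t) =
      ∑ x ∈ Finset.HasAntidiagonal.antidiagonal t, (∑ y ∈ Finset.HasAntidiagonal.antidiagonal x.1,
        b₁ ^ y.1 * (n.choose y.1 : R) * (b₂ ^ y.2 * (n.choose y.2 : R))) *
          (b₃ ^ x.2 * (n.choose x.2 : R)) := by
  have h : (((X + C b₁) * (X + C b₂) * (X + C b₃)) ^ n).coeff (3 * n - t) =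
      (reflect (n + n + n) ((X + C b₁) ^ n * (X + C b₂) ^ n * (X + C b₃) ^ n)).coeff t := by
    rw [coeff_reflect, revAt_le (by omega), mul_pow, mul_pow]
    congr 1
    omega
  rw [h, reflect_mul _ _ (natDegree_mul_le_of_le (deg_pow b₁ n) (deg_pow b₂ n)) (deg_pow b₃ n),
    reflect_mul _ _ (deg_pow b₁ n) (deg_pow b₂ n), coeff_mul]
  refine Finset.sum_congr rfl fun x hx => ?_
  have hx' := Finset.HasAntidiagonal.mem_antidiagonal.1 hx
  rw [coeff_mul, coeff_refl b₃ (by omega)]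
  congr 1
  refine Finset.sum_congr rfl fun y hy => ?_
  have hy' := Finset.HasAntidiagonal.mem_antidiagonal.1 hy
  rw [coeff_refl b₁ (by omega), coeff_refl b₂ (by omega)]

lemma field_case (p : ℕ) [hp : Fact p.Prime] (k a₁ a₂ a₃ b₁ b₂ b₃ : ZMod p) :
    ∃ ρ : ZMod p, ∀ t : ℕ, t < p → ∃ P : Polynomial (ZMod p),
      P.natDegree ≤ t ∧ binomPolyZMod p (t / 3) ∣ P ∧
      ∀ n : ℕ, t < n →
        (((C a₁ * X + C b₁) * (C a₂ * X + C b₂) * (C a₃ * X + C b₃) * C k) ^ n).coeff (3*n - t)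
          = ρ ^ n * P.eval (n : ZMod p) := by
  by_cases h0 : a₁ * a₂ * a₃ * k = 0
  · refine ⟨0, fun t _ => ⟨0, by simp, by simp, fun n hn => ?_⟩⟩
    rw [eval_zero, mul_zero]
    apply coeff_eq_zero_of_natDegree_lt
    refine lt_of_le_of_lt (b := n * 2) (natDegree_pow_le.trans (Nat.mul_le_mul_left n ?_)) (by omega)
    rw [natDegree_le_iff_coeff_eq_zero]
    intro N hN
    have e : (C a₁ * X + C b₁) * (C a₂ * X + C b₂) * (C a₃ * X + C b₃) * C k =
        C (a₁ * a₂ * a₃ * k) * X ^ 3 +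
        (C (k * (a₁ * a₂ * b₃ + a₁ * b₂ * a₃ + b₁ * a₂ * a₃)) * X ^ 2
        + C (k * (a₁ * b₂ * b₃ + b₁ * a₂ * b₃ + b₁ * b₂ * a₃)) * X + C (k * (b₁ * b₂ * b₃))) := by
      simp only [C_mul, C_add]; ring
    rw [e, h0, C_0, zero_mul, zero_add]
    apply coeff_eq_zero_of_natDegree_lt
    exact lt_of_le_of_lt natDegree_quadratic_le hN
  · have h1 : a₁ ≠ 0 := by rintro rfl; simp at h0
    have h2 : a₂ ≠ 0 := by rintro rfl; simp at h0
    have h3 : a₃ ≠ 0 := by rintro rfl; simp at h0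
    refine ⟨a₁ * a₂ * a₃ * k, fun t ht => ?_⟩
    set B := binomPolyZMod p with hB
    refine ⟨∑ x ∈ Finset.HasAntidiagonal.antidiagonal t, (∑ y ∈ Finset.HasAntidiagonal.antidiagonal x.1,
        C ((b₁ / a₁) ^ y.1) * B y.1 * (C ((b₂ / a₂) ^ y.2) * B y.2)) *
          (C ((b₃ / a₃) ^ x.2) * B x.2), ?_, ?_, ?_⟩
    · refine natDegree_sum_le_of_forall_le _ _ fun x hx => ?_
      rw [← Finset.HasAntidiagonal.mem_antidiagonal.1 hx]
      refine natDegree_mul_le_of_le ?_ ((natDegree_C_mul_le _ _).trans (binom_deg p _))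
      refine natDegree_sum_le_of_forall_le _ _ fun y hy => ?_
      rw [← Finset.HasAntidiagonal.mem_antidiagonal.1 hy]
      exact natDegree_mul_le_of_le ((natDegree_C_mul_le _ _).trans (binom_deg p _))
        ((natDegree_C_mul_le _ _).trans (binom_deg p _))
    · refine Finset.dvd_sum fun x hx => ?_
      have hx' := Finset.HasAntidiagonal.mem_antidiagonal.1 hx
      have hlt : t / 3 < p := by omega
      by_cases hc : t / 3 ≤ x.2
      · exact Dvd.dvd.mul_left (Dvd.dvd.mul_left (binom_dvd hlt hc) _) _
      refine Dvd.dvd.mul_right (Finset.dvd_sum fun y hy => ?_) _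
      have hy' := Finset.HasAntidiagonal.mem_antidiagonal.1 hy
      by_cases hc2 : t / 3 ≤ y.2
      · exact Dvd.dvd.mul_left (Dvd.dvd.mul_left (binom_dvd hlt hc2) _) _
      · exact Dvd.dvd.mul_right (Dvd.dvd.mul_left (binom_dvd hlt (by omega)) _) _
    · intro n hn
      have e : (C a₁ * X + C b₁) * (C a₂ * X + C b₂) * (C a₃ * X + C b₃) * C k =
          C (a₁ * a₂ * a₃ * k) *
            ((X + C (b₁ / a₁)) * (X + C (b₂ / a₂)) * (X + C (b₃ / a₃))) := by
        have f : ∀ a b : ZMod p, a ≠ 0 → C a * X + C b = C a * (X + C (b / a)) := by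
          intro a b h
          rw [mul_add, ← C_mul, mul_div_cancel₀ _ h]
        rw [f _ b₁ h1, f _ b₂ h2, f _ b₃ h3]
        simp only [C_mul]; ring
      rw [e, mul_pow, ← C_pow, coeff_C_mul, main_coeff _ _ _ hn]
      congr 1
      rw [eval_finsetSum]
      refine Finset.sum_congr rfl fun x hx => ?_
      have hx' := Finset.HasAntidiagonal.mem_antidiagonal.1 hx
      rw [eval_mul, eval_finsetSum, eval_mul, eval_C, hB, binom_eval (by omega) (by omega)]
      congr 1
      refine Finset.sum_congr rfl fun y hy => ?_
      have hy' := Finset.HasAntidiagonal.mem_antidiagonal.1 hy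
      rw [eval_mul, eval_mul, eval_mul, eval_C, eval_C, binom_eval (by omega) (by omega),
        binom_eval (by omega) (by omega)]

end Polynomial.S14

theorem stmt14 (m₁ m₂ m₃ : Fin 3 → ℤ) (lam mu : ℤ) (p : ℕ) (hp : p.Prime) :
    ∃ ρ : ZMod p, ∀ t : ℕ, t < p → ∃ P : Polynomial (ZMod p),
      P.natDegree ≤ t ∧ binomPolyZMod p (t / 3) ∣ P ∧
      ∀ n : ℕ, t < n →
        ((((IcovR ![Polynomial.X, Polynomial.C lam, Polynomial.C mu]
            (fun j => Polynomial.C (m₁ j)) (fun j => Polynomial.C (m₂ j))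
            (fun j => Polynomial.C (m₃ j))) ^ n).coeff (3*n - t) : ℤ) : ZMod p)
          = ρ ^ n * P.eval (n : ZMod p) := by
  haveI : Fact p.Prime := ⟨hp⟩
  obtain ⟨a₁, b₁, h₁⟩ := Polynomial.S14.br_lin m₁ m₂ lam mu
  obtain ⟨a₂, b₂, h₂⟩ := Polynomial.S14.br_lin m₁ m₃ lam mu
  obtain ⟨a₃, b₃, h₃⟩ := Polynomial.S14.br_lin m₂ m₃ lam mu
  obtain ⟨k, hk⟩ := Polynomial.S14.br_const m₁ m₂ m₃
  obtain ⟨ρ, H⟩ := Polynomial.S14.field_case p k a₁ a₂ a₃ b₁ b₂ b₃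
  refine ⟨ρ, fun t ht => ?_⟩
  obtain ⟨P, hd, hv, hP⟩ := H t ht
  refine ⟨P, hd, hv, fun n hn => ?_⟩
  rw [← hP n hn]
  unfold IcovR
  rw [h₁, h₂, h₃, hk, ← eq_intCast (Int.castRingHom (ZMod p)), ← Polynomial.coeff_map]
  simp
end
end

section
/- Let m₁,…,m_N be linear forms in ℂ[x₁,x₂,x₃], let y = λx₂+μx₃ with (λ,μ) ≠ (0,0), and for each integer n ≥ 1 set d = 3n+1 and define G_n := −24 · Σ_{1≤i<k<p≤N} I(c x₁+y, m_i, m_k, m_p)^n · (c x₁ + y) · m_i m_k m_p ∈ ℂ[c, x₁, x₂, x₃]. Fix an integer j ≥ 0 and an exponent vector e ∈ ℕ³ with e₁+e₂+e₃ = 4. Then there exist complex numbers ρ₁,…,ρ_M and polynomials P₁,…,P_M ∈ ℂ[X] with deg P_ν ≤ j, where M = C(N,3), all independent of n, such that for every integer n > j the coefficient of c^{3n+1−j}·x₁^{e₁}x₂^{e₂}x₃^{e₃} in G_n equals Σ_{ν=1}^M ρ_ν^n · P_ν(n). -/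
open MvPolynomial

noncomputable section

lemma binomPoly_eval15 (k n : ℕ) : (binomPoly k).eval (n : ℂ) = (n.choose k : ℂ) := by
  have h : ∀ k : ℕ, ∏ i ∈ Finset.range k, ((n : ℂ) - (i : ℂ)) = (n.descFactorial k : ℂ) := by
    intro k
    induction k with
    | zero => simp
    | succ k ih =>
      rw [Finset.prod_range_succ, ih, Nat.descFactorial_succ]
      by_cases hk : k ≤ n
      · push_cast [Nat.cast_sub hk]; ring
      · rw [Nat.descFactorial_of_lt (by omega)]; simp
  unfold binomPoly
  rw [Polynomial.eval_mul, Polynomial.eval_prod]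
  simp only [Polynomial.eval_C, Polynomial.eval_sub, Polynomial.eval_X]
  rw [h, Nat.descFactorial_eq_factorial_mul_choose]
  have : (k.factorial : ℂ) ≠ 0 := by exact_mod_cast k.factorial_ne_zero
  push_cast
  field_simp

lemma binomPoly_deg15 (k : ℕ) : (binomPoly k).natDegree ≤ k := by
  unfold binomPoly
  refine (Polynomial.natDegree_C_mul_le _ _).trans ?_
  refine (Polynomial.natDegree_prod_le _ _).trans ?_
  simp only [Polynomial.natDegree_X_sub_C, Finset.sum_const, Finset.card_range, smul_eq_mul, mul_one,
    le_refl]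

lemma one_add_pow15 (r : Polynomial ℂ) (i n : ℕ) :
    ((Polynomial.X * r + 1) ^ n).coeff i
      = ∑ k ∈ Finset.range (i+1), (n.choose k : ℂ) * (r ^ k).coeff (i - k) := by
  rw [add_pow, Polynomial.finsetSum_coeff]
  have h1 : ∀ k, ((Polynomial.X * r) ^ k * 1 ^ (n - k) * ((n.choose k : ℕ) : Polynomial ℂ)).coeff i
      = if k ≤ i then (n.choose k : ℂ) * (r ^ k).coeff (i - k) else 0 := by
    intro k
    rw [mul_pow, one_pow, mul_one, mul_assoc, Polynomial.coeff_X_pow_mul',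
      Polynomial.coeff_mul_natCast, mul_comm]
  simp only [h1]
  have h2 : ∀ k, k ∈ Finset.range (n+1) ∪ Finset.range (i+1) →
     k ∉ Finset.range (n+1) → (if k ≤ i then (n.choose k : ℂ) * (r ^ k).coeff (i - k) else 0) = 0 := by
    intro k _ hk
    rw [Nat.choose_eq_zero_of_lt (by simpa using hk)]; simp
  rw [Finset.sum_subset (Finset.subset_union_left (s₂ := Finset.range (i+1))) h2,
    ← Finset.sum_subset (Finset.subset_union_right (s₁ := Finset.range (n+1)))]
  · refine Finset.sum_congr rfl fun k hk => ?_
    rw [if_pos (by simpa [Nat.lt_succ_iff] using hk)]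
  · intro k _ hk
    rw [if_neg]
    simpa [Nat.lt_succ_iff] using hk

lemma reflect_pow15 (q : Polynomial ℂ) (hq : q.natDegree ≤ 3) (n : ℕ) :
    Polynomial.reflect (3*n) (q^n) = (Polynomial.reflect 3 q)^n := by
  induction n with
  | zero => simp
  | succ n ih =>
    rw [pow_succ, pow_succ, ← ih, mul_add, mul_one, Polynomial.reflect_mul _ _ _ hq]
    exact (Polynomial.natDegree_pow_le_of_le n hq).trans (by omega)

lemma coeff_pow15 (q : Polynomial ℂ) (hq : q.natDegree ≤ 3) (h3 : q.coeff 3 ≠ 0) (i : ℕ) :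
    ∃ P : Polynomial ℂ, P.natDegree ≤ i ∧ ∀ n : ℕ, i ≤ 3*n →
      (q^n).coeff (3*n - i) = q.coeff 3 ^ n * P.eval (n:ℂ) := by
  set a := q.coeff 3
  set s := Polynomial.C a⁻¹ * Polynomial.reflect 3 q with hs
  have hs0 : s.coeff 0 = 1 := by
    rw [hs, Polynomial.coeff_C_mul, Polynomial.coeff_reflect]
    simp only [Polynomial.revAt_le (Nat.zero_le 3)]
    exact inv_mul_cancel₀ h3
  have hX : s = Polynomial.X * s.divX + 1 := by
    conv_lhs => rw [← Polynomial.X_mul_divX_add s, hs0]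
    simp
  have hr : Polynomial.reflect 3 q = Polynomial.C a * s := by
    rw [hs, ← mul_assoc, ← Polynomial.C_mul, mul_inv_cancel₀ h3]; simp
  refine ⟨∑ k ∈ Finset.range (i+1), Polynomial.C ((s.divX ^ k).coeff (i - k)) * binomPoly k, ?_, ?_⟩
  · refine Polynomial.natDegree_sum_le_of_forall_le _ _ fun k hk => ?_
    refine (Polynomial.natDegree_C_mul_le _ _).trans ((binomPoly_deg15 k).trans ?_)
    simpa [Nat.lt_succ_iff] using hk
  · intro n hn
    have : (q^n).coeff (3*n-i) = (Polynomial.reflect (3*n) (q^n)).coeff i := by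
      rw [Polynomial.coeff_reflect, Polynomial.revAt_le hn]
    rw [this, reflect_pow15 q hq, hr, mul_pow, ← Polynomial.C_pow, Polynomial.coeff_C_mul]
    congr 1
    conv_lhs => rw [hX]
    rw [one_add_pow15, Polynomial.eval_finsetSum]
    refine Finset.sum_congr rfl fun k _ => ?_
    rw [Polynomial.eval_mul, Polynomial.eval_C, binomPoly_eval15, mul_comm]

/-- the combination of two adjacent coefficients -/
lemma comb15 (q : Polynomial ℂ) (hq : q.natDegree ≤ 3) (j : ℕ) (α β : ℂ) :
    ∃ (ρ : ℂ) (P : Polynomial ℂ), P.natDegree ≤ j ∧ ∀ n : ℕ, j < n →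
      (q^n).coeff (3*n - j) * α + (q^n).coeff (3*n+1-j) * β = ρ ^ n * P.eval (n:ℂ) := by
  by_cases h3 : q.coeff 3 = 0
  · refine ⟨0, 0, by simp, fun n hn => ?_⟩
    have hq2 : q.natDegree ≤ 2 := by
      rw [Polynomial.natDegree_le_iff_coeff_eq_zero] at hq ⊢
      intro k hk
      rcases Nat.lt_or_ge 3 k with h | h
      · exact hq k h
      · obtain rfl : k = 3 := by omega
        exact h3
    have hd := Polynomial.natDegree_pow_le_of_le n hq2
    rw [Polynomial.coeff_eq_zero_of_natDegree_lt (by omega),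
      Polynomial.coeff_eq_zero_of_natDegree_lt (by omega)]
    simp
  · obtain ⟨P, hP, hPe⟩ := coeff_pow15 q hq h3 j
    rcases j with _ | j
    · refine ⟨q.coeff 3, Polynomial.C α * P, (Polynomial.natDegree_C_mul_le _ _).trans hP, fun n hn => ?_⟩
      have hd := Polynomial.natDegree_pow_le_of_le n hq
      rw [hPe n (by omega), Polynomial.coeff_eq_zero_of_natDegree_lt (n := 3*n+1-0) (by omega)]
      simp; ring
    · obtain ⟨P', hP', hPe'⟩ := coeff_pow15 q hq h3 j
      refine ⟨q.coeff 3, Polynomial.C α * P + Polynomial.C β * P', ?_, fun n hn => ?_⟩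
      · refine Polynomial.natDegree_add_le_of_degree_le ((Polynomial.natDegree_C_mul_le _ _).trans hP)
          ((Polynomial.natDegree_C_mul_le _ _).trans (hP'.trans (by omega)))
      · rw [hPe n (by omega), show 3*n+1-(j+1) = 3*n - j by omega, hPe' n (by omega)]
        simp; ring

lemma term15 (q : Polynomial ℂ) (lam mu : ℂ) (w : MvP) (n j : ℕ) (e : Fin 3 →₀ ℕ) (hj : j < n) :
    MvPolynomial.coeff e ((Polynomial.map (MvPolynomial.C) (q ^ n) * cLin lam mu
        * Polynomial.C w : Polynomial MvP).coeff (3*n+1-j))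
     = (q^n).coeff (3*n - j) * MvPolynomial.coeff e (X 0 * w)
      + (q^n).coeff (3*n+1-j) * MvPolynomial.coeff e ((C lam * X 1 + C mu * X 2) * w) := by
  have h : 3*n+1-j = (3*n-j)+1 := by omega
  rw [h, Polynomial.coeff_mul_C]
  unfold cLin
  rw [mul_add, ← mul_assoc, Polynomial.coeff_add, Polynomial.coeff_mul_C, Polynomial.coeff_mul_C,
    Polynomial.coeff_mul_X, Polynomial.coeff_map, Polynomial.coeff_map, add_mul, mul_assoc, mul_assoc,
    MvPolynomial.coeff_add, MvPolynomial.coeff_C_mul, MvPolynomial.coeff_C_mul]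

lemma icov_deg15 (lam mu : ℂ) (a b c : Fin 3 → ℂ) :
    (IcovR ![Polynomial.X, Polynomial.C lam, Polynomial.C mu]
            (fun j => Polynomial.C (a j)) (fun j => Polynomial.C (b j))
            (fun j => Polynomial.C (c j))).natDegree ≤ 3 := by
  unfold IcovR brR
  simp only [Matrix.det_fin_three, Matrix.of_apply, Matrix.cons_val_zero, Matrix.cons_val_one,
    Matrix.cons_val]
  compute_degree

def T15 (N : ℕ) : Finset (Fin N × Fin N × Fin N) :=
  Finset.univ.filter fun t => t.1 < t.2.1 ∧ t.2.1 < t.2.2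

lemma card_T15 (N : ℕ) : (T15 N).card = N.choose 3 := by
  have : N.choose 3 = (Finset.powersetCard 3 (Finset.univ : Finset (Fin N))).card := by simp
  rw [this]
  refine Finset.card_bij (fun t _ => {t.1, t.2.1, t.2.2}) ?_ ?_ ?_
  · rintro ⟨a, b, c⟩ h
    simp only [T15, Finset.mem_filter, Finset.mem_univ, true_and] at h
    simp only [Finset.mem_powersetCard, Finset.subset_univ, true_and]
    exact Finset.card_eq_three.2 ⟨a, b, c, h.1.ne, (h.1.trans h.2).ne, h.2.ne, rfl⟩
  · rintro ⟨a, b, c⟩ h ⟨a', b', c'⟩ h' hh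
    simp only [T15, Finset.mem_filter, Finset.mem_univ, true_and] at h h'
    simp only [Finset.ext_iff, Finset.mem_insert, Finset.mem_singleton] at hh
    have h1 := (hh a).1 (by simp)
    have h2 := (hh b).1 (by simp)
    have h3 := (hh c).1 (by simp)
    have h4 := (hh a').2 (by simp)
    have h5 := (hh b').2 (by simp)
    have h6 := (hh c').2 (by simp)
    simp only [Prod.mk.injEq]
    clear hh
    simp only [Fin.ext_iff, Fin.lt_def] at h h' h1 h2 h3 h4 h5 h6 ⊢
    omega
  · intro s hs
    simp only [Finset.mem_powersetCard, Finset.subset_univ, true_and] at hs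
    let f := s.orderEmbOfFin hs
    refine ⟨(f 0, f 1, f 2), ?_, ?_⟩
    · simp [T15, f]
    · have := Finset.range_orderEmbOfFin s hs
      ext x
      rw [← Finset.mem_coe (s := s), ← this]
      simp only [Finset.mem_insert, Finset.mem_singleton, Set.mem_range, Fin.exists_fin_succ]
      simp [f, eq_comm]

theorem stmt15 (N : ℕ) (m : Fin N → Fin 3 → ℂ) (lam mu : ℂ) (hlm : (lam, mu) ≠ (0, 0))
    (j : ℕ) (e : Fin 3 →₀ ℕ) (he : e 0 + e 1 + e 2 = 4) :
    ∃ (ρ : Fin (N.choose 3) → ℂ) (P : Fin (N.choose 3) → Polynomial ℂ),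
      (∀ ν, (P ν).natDegree ≤ j) ∧
      ∀ n : ℕ, j < n →
        MvPolynomial.coeff e ((Gpoly m lam mu n).coeff (3*n+1 - j))
          = ∑ ν, ρ ν ^ n * (P ν).eval (n : ℂ) := by
  classical
  let q : Fin N × Fin N × Fin N → Polynomial ℂ := fun t =>
    IcovR ![Polynomial.X, Polynomial.C lam, Polynomial.C mu]
            (fun j => Polynomial.C (m t.1 j)) (fun j => Polynomial.C (m t.2.1 j))
            (fun j => Polynomial.C (m t.2.2 j))
  let w : Fin N × Fin N × Fin N → MvP := fun t => lin (m t.1) * lin (m t.2.1) * lin (m t.2.2)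
  have hc := fun t => comb15 (q t) (icov_deg15 lam mu _ _ _) j
    (-24 * MvPolynomial.coeff e (X 0 * w t))
    (-24 * MvPolynomial.coeff e ((C lam * X 1 + C mu * X 2) * w t))
  choose ρ P hP hE using hc
  let E : Fin (N.choose 3) ≃ T15 N := ((T15 N).equivFinOfCardEq (card_T15 N)).symm
  refine ⟨fun ν => ρ (E ν), fun ν => P (E ν), fun ν => hP _, fun n hn => ?_⟩
  rw [E.sum_comp (fun t : T15 N => ρ t ^ n * (P t).eval (n:ℂ)),
    Finset.sum_coe_sort (T15 N) (fun t => ρ t ^ n * (P t).eval (n:ℂ))]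
  have hG : Gpoly m lam mu n = Polynomial.C (C (-24)) * ∑ t ∈ T15 N,
      Polynomial.map (MvPolynomial.C) (q t ^ n) * cLin lam mu * Polynomial.C (w t) := by
    unfold Gpoly T15
    rw [Finset.sum_filter, Fintype.sum_prod_type]
    simp only [Fintype.sum_prod_type]
    congr 1
    rw [map_neg, map_neg, map_ofNat, map_ofNat]
  rw [hG, Polynomial.coeff_C_mul, MvPolynomial.coeff_C_mul, Polynomial.finsetSum_coeff,
    MvPolynomial.coeff_sum, Finset.mul_sum]
  refine Finset.sum_congr rfl fun t _ => ?_
  rw [term15 _ _ _ _ _ _ _ hn, ← hE t n hn]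
  ring
end
end

section
/- Let n ≥ 12, d = 3n+1, and let Φ be the Clebsch covariant of degree d. Then there exists g ∈ V(d) such that the set {Φ(h,g,g,g) : h ∈ L_S} ∪ {Φ(g,g,g,g)} spans the 15-dimensional space V(4). (Equivalently: the linear map obtained by restricting S_d : f ↦ Φ(f,f,f,f) to ℙ(L_S + ℂg) is surjective onto ℙV(4).) -/
open MvPolynomial

noncomputable section

/-! ### Foundations -/

def mx (i j k : ℕ) : MvP := X 0 ^ i * X 1 ^ j * X 2 ^ k

def prj (d : ℕ) : MvP →ₗ[ℂ] V d :=
  (homogeneousComponent d).codRestrict (V d) (fun p => homogeneousComponent_mem d p)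

lemma prj_val (d : ℕ) (p : MvP) : ((prj d p : V d) : MvP) = homogeneousComponent d p := rfl

def mV (d i j k : ℕ) : V d := prj d (mx i j k)

lemma mx_hom (i j k : ℕ) : (mx i j k).IsHomogeneous (i+j+k) := by
  unfold mx
  exact ((isHomogeneous_X_pow _ _).mul (isHomogeneous_X_pow _ _)).mul (isHomogeneous_X_pow _ _)

lemma prj_coe {d : ℕ} (p : V d) : prj d (p : MvP) = p := by
  apply Subtype.ext
  have h : (p : MvP) ∈ homogeneousSubmodule (Fin 3) ℂ d := p.2
  rw [prj_val, homogeneousComponent_of_mem h, if_pos rfl]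

lemma mV_coe {d i j k : ℕ} (h : i + j + k = d) : ((mV d i j k : V d) : MvP) = mx i j k := by
  have h' : mx i j k ∈ homogeneousSubmodule (Fin 3) ℂ d := by
    rw [mem_homogeneousSubmodule]; subst h; exact mx_hom i j k
  rw [mV, prj_val, homogeneousComponent_of_mem h', if_pos rfl]

lemma mV_zero {d i j k : ℕ} (h : i + j + k ≠ d) : (mV d i j k : V d) = 0 := by
  apply Subtype.ext
  have h' : mx i j k ∈ homogeneousSubmodule (Fin 3) ℂ (i+j+k) := by
    rw [mem_homogeneousSubmodule]; exact mx_hom i j k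
  rw [mV, prj_val, homogeneousComponent_of_mem h', if_neg (Ne.symm h)]; rfl

lemma tri_expand {R : Type*} [CommRing R] (x y z : R) (d : ℕ) :
    (x + (y + z)) ^ d = ∑ i ∈ Finset.range (d+1), ∑ j ∈ Finset.range (d+1),
      ((d.choose i * (d-i).choose j : ℕ) : R) * (x ^ i * y ^ j * z ^ (d - i - j)) := by
  rw [add_pow]
  apply Finset.sum_congr rfl
  intro i hi
  have hi' : i ≤ d := by simpa [Nat.lt_succ_iff] using hi
  rw [add_pow, Finset.mul_sum, Finset.sum_mul]
  have hsub : Finset.range (d - i + 1) ⊆ Finset.range (d+1) := by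
    apply Finset.range_subset_range.2; omega
  rw [← Finset.sum_subset hsub]
  · apply Finset.sum_congr rfl
    intro j hj
    push_cast; ring
  · intro j _ hj
    have : d - i < j := by simpa [Nat.lt_succ_iff] using hj
    rw [Nat.choose_eq_zero_of_lt this]; simp

lemma powV_prj (d : ℕ) (a : Fin 3 → ℂ) : powV d a = prj d (lin a ^ d) := by
  rw [← prj_coe (powV d a)]; rfl

lemma mxC (a b c : ℂ) (i j k : ℕ) (m : ℕ) :
    ((m : ℕ) : MvP) * ((C a * X 0) ^ i * (C b * X 1) ^ j * (C c * X 2) ^ k)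
      = ((m : ℂ) * a ^ i * b ^ j * c ^ k) • mx i j k := by
  rw [MvPolynomial.smul_eq_C_mul, mx]
  simp only [C_mul, C_pow, mul_pow, map_natCast]
  ring

lemma powV_012 (d : ℕ) (a b c : ℂ) : powV d ![a,b,c] =
    ∑ i ∈ Finset.range (d+1), ∑ j ∈ Finset.range (d+1),
      (((d.choose i * (d-i).choose j : ℕ) : ℂ) * a ^ i * b ^ j * c ^ (d-i-j)) •
        mV d i j (d-i-j) := by
  rw [powV_prj]
  have : lin ![a,b,c] = C a * X 0 + (C b * X 1 + C c * X 2) := by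
    simp [lin, Fin.sum_univ_three, add_assoc]
  rw [this, tri_expand]
  simp only [map_sum, mV, ← map_smul]
  refine Finset.sum_congr rfl fun i _ => Finset.sum_congr rfl fun j _ => ?_
  rw [mxC]

lemma powV_021 (d : ℕ) (a b c : ℂ) : powV d ![a,b,c] =
    ∑ i ∈ Finset.range (d+1), ∑ j ∈ Finset.range (d+1),
      (((d.choose i * (d-i).choose j : ℕ) : ℂ) * a ^ i * b ^ (d-i-j) * c ^ j) •
        mV d i (d-i-j) j := by
  rw [powV_prj]
  have : lin ![a,b,c] = C a * X 0 + (C c * X 2 + C b * X 1) := by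
    simp [lin, Fin.sum_univ_three]; ring
  rw [this, tri_expand]
  simp only [map_sum, mV, ← map_smul]
  refine Finset.sum_congr rfl fun i _ => Finset.sum_congr rfl fun j _ => ?_
  refine congrArg (prj d) ?_
  rw [← mxC]
  generalize (C a * X 0 : MvP) = x
  generalize (C b * X 1 : MvP) = y
  generalize (C c * X 2 : MvP) = z
  ring

lemma powV_120 (d : ℕ) (a b c : ℂ) : powV d ![a,b,c] =
    ∑ i ∈ Finset.range (d+1), ∑ j ∈ Finset.range (d+1),
      (((d.choose i * (d-i).choose j : ℕ) : ℂ) * a ^ (d-i-j) * b ^ i * c ^ j) •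
        mV d (d-i-j) i j := by
  rw [powV_prj]
  have : lin ![a,b,c] = C b * X 1 + (C c * X 2 + C a * X 0) := by
    simp [lin, Fin.sum_univ_three]; ring
  rw [this, tri_expand]
  simp only [map_sum, mV, ← map_smul]
  refine Finset.sum_congr rfl fun i _ => Finset.sum_congr rfl fun j _ => ?_
  refine congrArg (prj d) ?_
  rw [← mxC]
  generalize (C a * X 0 : MvP) = x
  generalize (C b * X 1 : MvP) = y
  generalize (C c * X 2 : MvP) = z
  ring

lemma extract1 (N : ℕ) (w : ℕ → ℂ) (p : Polynomial ℂ)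
    (h : ∀ t, ∑ i ∈ Finset.range N, w i * t ^ i = p.eval t) (i : ℕ) (hi : i < N) :
    w i = p.coeff i := by
  have : p = ∑ i ∈ Finset.range N, Polynomial.C (w i) * Polynomial.X ^ i := by
    apply Polynomial.funext
    intro t
    rw [← h t]
    simp [Polynomial.eval_finsetSum]
  rw [this]
  simp [Polynomial.coeff_C_mul, Polynomial.coeff_X_pow, hi]

lemma extract2 (N : ℕ) (w : ℕ → ℕ → ℂ) (P : ℂ → Polynomial ℂ) (p : Polynomial ℂ)
    (h : ∀ s t, ∑ i ∈ Finset.range N, ∑ j ∈ Finset.range N, w i j * s ^ i * t ^ j = (P s).eval t)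
    (i j : ℕ) (hi : i < N) (hj : j < N) (hp : ∀ s, (P s).coeff j = p.eval s) :
    w i j = p.coeff i := by
  apply extract1 N (fun i => w i j) p _ i hi
  intro s
  rw [← hp s]
  refine extract1 N (fun j => ∑ i ∈ Finset.range N, w i j * s ^ i) (P s) ?_ j hj
  intro t
  rw [← h s t, Finset.sum_comm]
  refine Finset.sum_congr rfl fun j _ => ?_
  rw [Finset.sum_mul]

section ex
variable {d : ℕ} (φ : V d →ₗ[ℂ] ℂ)

lemma ex012 (P : ℂ → Polynomial ℂ) (p : Polynomial ℂ)
    (h : ∀ s t, φ (powV d ![s,t,1]) = (P s).eval t) (i j : ℕ) (hij : i + j ≤ d)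
    (hp : ∀ s, (P s).coeff j = p.eval s) :
    ((d.choose i * (d-i).choose j : ℕ) : ℂ) * φ (mV d i j (d-i-j)) = p.coeff i := by
  refine extract2 (d+1) (fun i j => ((d.choose i * (d-i).choose j : ℕ) : ℂ) * φ (mV d i j (d-i-j)))
    P p ?_ i j (by omega) (by omega) hp
  intro s t
  rw [← h s t, powV_012]
  simp only [map_sum, map_smul, smul_eq_mul, one_pow, mul_one]
  refine Finset.sum_congr rfl fun i _ => Finset.sum_congr rfl fun j _ => ?_
  ring

lemma ex021 (P : ℂ → Polynomial ℂ) (p : Polynomial ℂ)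
    (h : ∀ s t, φ (powV d ![s,1,t]) = (P s).eval t) (i j : ℕ) (hij : i + j ≤ d)
    (hp : ∀ s, (P s).coeff j = p.eval s) :
    ((d.choose i * (d-i).choose j : ℕ) : ℂ) * φ (mV d i (d-i-j) j) = p.coeff i := by
  refine extract2 (d+1) (fun i j => ((d.choose i * (d-i).choose j : ℕ) : ℂ) * φ (mV d i (d-i-j) j))
    P p ?_ i j (by omega) (by omega) hp
  intro s t
  rw [← h s t, powV_021]
  simp only [map_sum, map_smul, smul_eq_mul, one_pow, mul_one]
  refine Finset.sum_congr rfl fun i _ => Finset.sum_congr rfl fun j _ => ?_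
  ring

lemma ex120 (P : ℂ → Polynomial ℂ) (p : Polynomial ℂ)
    (h : ∀ s t, φ (powV d ![1,s,t]) = (P s).eval t) (i j : ℕ) (hij : i + j ≤ d)
    (hp : ∀ s, (P s).coeff j = p.eval s) :
    ((d.choose i * (d-i).choose j : ℕ) : ℂ) * φ (mV d (d-i-j) i j) = p.coeff i := by
  refine extract2 (d+1) (fun i j => ((d.choose i * (d-i).choose j : ℕ) : ℂ) * φ (mV d (d-i-j) i j))
    P p ?_ i j (by omega) (by omega) hp
  intro s t
  rw [← h s t, powV_120]
  simp only [map_sum, map_smul, smul_eq_mul, one_pow, mul_one]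
  refine Finset.sum_congr rfl fun i _ => Finset.sum_congr rfl fun j _ => ?_
  ring

lemma exB (p : Polynomial ℂ) (h : ∀ t, φ (powV d ![t,1,0]) = p.eval t) (hd : 1 ≤ d) :
    (d : ℂ) * φ (mV d 1 (d-1) 0) = p.coeff 1 := by
  have := extract1 (d+1) (fun i => (d.choose i : ℂ) * φ (mV d i (d-i) 0)) p ?_ 1 (by omega)
  · simpa using this
  intro t
  rw [← h t, powV_021]
  simp only [map_sum, map_smul, smul_eq_mul, one_pow, mul_one]
  refine Finset.sum_congr rfl fun i _ => ?_
  rw [Finset.sum_eq_single 0]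
  · simp; ring
  · intro j _ hj; simp [hj]
  · simp

lemma exC (p : Polynomial ℂ) (h : ∀ t, φ (powV d ![t,0,1]) = p.eval t) (hd : 1 ≤ d) :
    (d : ℂ) * φ (mV d 1 0 (d-1)) = p.coeff 1 := by
  have := extract1 (d+1) (fun i => (d.choose i : ℂ) * φ (mV d i 0 (d-i))) p ?_ 1 (by omega)
  · simpa using this
  intro t
  rw [← h t, powV_012]
  simp only [map_sum, map_smul, smul_eq_mul, one_pow, mul_one]
  refine Finset.sum_congr rfl fun i _ => ?_
  rw [Finset.sum_eq_single 0]
  · simp; ring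
  · intro j _ hj; simp [hj]
  · simp

end ex

lemma mV_span (d : ℕ) (U : Submodule ℂ (V d)) (h : ∀ i j k, mV d i j k ∈ U) : U = ⊤ := by
  rw [eq_top_iff]
  intro f _
  rw [← prj_coe f, (f : MvP).as_sum, map_sum]
  refine Submodule.sum_mem _ fun s _ => ?_
  have : (monomial s (coeff s (f:MvP)) : MvP) = (coeff s (f:MvP)) • mx (s 0) (s 1) (s 2) := by
    rw [monomial_eq, MvPolynomial.smul_eq_C_mul, mx, Finsupp.prod_fintype _ _ (by simp)]
    simp [Fin.prod_univ_three]
  rw [this, map_smul]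
  exact U.smul_mem _ (h _ _ _)

lemma powV_span (d : ℕ) : Submodule.span ℂ (Set.range (powV d)) = ⊤ := by
  by_contra hne
  obtain ⟨φ, hφ, hle⟩ := Submodule.exists_le_ker_of_lt_top _ (lt_top_iff_ne_top.2 hne)
  apply hφ
  have hker : LinearMap.ker φ = ⊤ := by
    apply mV_span
    intro i j k
    rw [LinearMap.mem_ker]
    by_cases hd : i + j + k = d
    · have h0 : ∀ a, φ (powV d a) = 0 := fun a => by
        rw [← LinearMap.mem_ker]; exact hle (Submodule.subset_span ⟨a, rfl⟩)
      have := ex012 φ (fun _ => 0) 0 (fun s t => by simp [h0]) i j (by omega) (by simp)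
      have hk : d - i - j = k := by omega
      rw [hk] at this
      simp only [Polynomial.coeff_zero, mul_eq_zero, Nat.cast_eq_zero] at this
      rcases this with h | h
      · have h1 := Nat.choose_pos (show i ≤ d by omega)
        have h2 := Nat.choose_pos (show j ≤ d - i by omega)
        rcases h with h | h <;> omega
      · exact h
    · rw [mV_zero hd]; simp
  exact LinearMap.ker_eq_top.1 hker

/-! ### Slots and weights -/

section slots
variable {d : ℕ} {M : Type*} [AddCommGroup M] [Module ℂ M]
  (Φ : MultilinearMap ℂ (fun _ : Fin 4 => V d) M)

def sl0 (b c e : V d) : V d →ₗ[ℂ] M := Φ.toLinearMap ![0,b,c,e] 0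
def sl1 (a c e : V d) : V d →ₗ[ℂ] M := Φ.toLinearMap ![a,0,c,e] 1
def sl2 (a b e : V d) : V d →ₗ[ℂ] M := Φ.toLinearMap ![a,b,0,e] 2
def sl3 (a b c : V d) : V d →ₗ[ℂ] M := Φ.toLinearMap ![a,b,c,0] 3

lemma sl0_apply (a b c e : V d) : sl0 Φ b c e a = Φ ![a,b,c,e] := by
  simp only [sl0, MultilinearMap.toLinearMap_apply]
  congr 1; ext i : 1; fin_cases i <;> rfl
lemma sl1_apply (a b c e : V d) : sl1 Φ a c e b = Φ ![a,b,c,e] := by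
  simp only [sl1, MultilinearMap.toLinearMap_apply]
  congr 1; ext i : 1; fin_cases i <;> rfl
lemma sl2_apply (a b c e : V d) : sl2 Φ a b e c = Φ ![a,b,c,e] := by
  simp only [sl2, MultilinearMap.toLinearMap_apply]
  congr 1; ext i : 1; fin_cases i <;> rfl
lemma sl3_apply (a b c e : V d) : sl3 Φ a b c e = Φ ![a,b,c,e] := by
  simp only [sl3, MultilinearMap.toLinearMap_apply]
  congr 1; ext i : 1; fin_cases i <;> rfl

lemma lin_zero (φ : V d →ₗ[ℂ] M) (h : ∀ a, φ (powV d a) = 0) (x : V d) : φ x = 0 := by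
  have : LinearMap.ker φ = ⊤ := by
    rw [eq_top_iff, ← powV_span d, Submodule.span_le]
    rintro _ ⟨a, rfl⟩
    exact h a
  rw [← LinearMap.mem_ker, this]; trivial

lemma mult_zero (h : ∀ a b c e, Φ ![powV d a, powV d b, powV d c, powV d e] = 0)
    (w x y z : V d) : Φ ![w,x,y,z] = 0 := by
  rw [← sl0_apply]
  refine lin_zero _ (fun a => ?_) w
  rw [sl0_apply, ← sl1_apply]
  refine lin_zero _ (fun b => ?_) x
  rw [sl1_apply, ← sl2_apply]
  refine lin_zero _ (fun c => ?_) y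
  rw [sl2_apply, ← sl3_apply]
  refine lin_zero _ (fun e => ?_) z
  rw [sl3_apply]; exact h _ _ _ _

lemma smul4 (p q r s : ℂ) (w x y z : V d) :
    Φ ![p • w, q • x, r • y, s • z] = (p * q * r * s) • Φ ![w,x,y,z] := by
  rw [← sl0_apply, map_smul, sl0_apply, ← sl1_apply, map_smul, sl1_apply, ← sl2_apply, map_smul,
      sl2_apply, ← sl3_apply, map_smul, sl3_apply]
  simp only [smul_smul, mul_assoc]

end slots

def fs (i j k : ℕ) : Fin 3 →₀ ℕ := Finsupp.equivFunOnFinite.symm ![i,j,k]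

lemma mx_eq (i j k : ℕ) : mx i j k = monomial (fs i j k) 1 := by
  rw [monomial_eq, mx, Finsupp.prod_fintype _ _ (by simp)]
  simp [Fin.prod_univ_three, fs]

lemma fs_inj {i j k i' j' k' : ℕ} : fs i j k = fs i' j' k' ↔ i = i' ∧ j = j' ∧ k = k' := by
  constructor
  · intro h
    have h0 := DFunLike.congr_fun h 0
    have h1 := DFunLike.congr_fun h 1
    have h2 := DFunLike.congr_fun h 2
    simp [fs] at h0 h1 h2
    exact ⟨h0, h1, h2⟩
  · rintro ⟨rfl, rfl, rfl⟩; rfl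

lemma fs_eta (s : Fin 3 →₀ ℕ) : s = fs (s 0) (s 1) (s 2) := by
  ext i; fin_cases i <;> rfl

/-- coefficient functional -/
def cf (d i j k : ℕ) : V d →ₗ[ℂ] ℂ := (lcoeff ℂ (fs i j k)) ∘ₗ (V d).subtype

lemma cf_apply (d i j k : ℕ) (f : V d) : cf d i j k f = coeff (fs i j k) (f : MvP) := rfl

lemma cf_ext {d : ℕ} (f : V d) (h : ∀ i j k, i + j + k = d → cf d i j k f = 0) : f = 0 := by
  apply Subtype.ext
  ext s
  have hf : (f : MvP).IsHomogeneous d := f.2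
  by_cases hs : s 0 + s 1 + s 2 = d
  · have := h _ _ _ hs
    rw [cf_apply, ← fs_eta] at this
    simpa using this
  · have : coeff s (f : MvP) = 0 := by
      apply hf.coeff_eq_zero
      rw [Finsupp.degree_eq_sum]
      simpa [Fin.sum_univ_three] using hs
    simpa using this

lemma cf_mV {d i j k i' j' k' : ℕ} (h : i' + j' + k' = d) :
    cf d i j k (mV d i' j' k') = if i = i' ∧ j = j' ∧ k = k' then 1 else 0 := by
  rw [cf_apply, mV_coe h, mx_eq, coeff_monomial]
  congr 1
  rw [fs_inj]
  simp only [eq_comm]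

/-- substitution x_i -> t_i x_i -/
def scl (t : Fin 3 → ℂ) : MvP →ₐ[ℂ] MvP := aeval (fun i => C (t i) * X i)

lemma scl_mx (t : Fin 3 → ℂ) (i j k : ℕ) :
    scl t (mx i j k) = (t 0 ^ i * t 1 ^ j * t 2 ^ k) • mx i j k := by
  simp only [scl, mx, map_mul, map_pow, aeval_X, MvPolynomial.smul_eq_C_mul, mul_pow, C_mul, C_pow]
  ring

lemma scl_lin (t a : Fin 3 → ℂ) : scl t (lin a) = lin (fun i => t i * a i) := by
  simp only [scl, lin, map_sum, map_mul, aeval_X, C_mul]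
  refine Finset.sum_congr rfl fun i _ => ?_
  rw [show aeval (fun i => C (t i) * X i) (C (a i) : MvP) = (C (a i) : MvP) from algHom_C _ _]
  ring

lemma coeff_scl (t : Fin 3 → ℂ) (i j k : ℕ) (p : MvP) :
    coeff (fs i j k) (scl t p) = t 0 ^ i * t 1 ^ j * t 2 ^ k * coeff (fs i j k) p := by
  induction p using MvPolynomial.induction_on' with
  | monomial s a =>
    have : (monomial s a : MvP) = a • mx (s 0) (s 1) (s 2) := by
      rw [mx_eq, ← fs_eta, smul_monomial]; simp
    rw [this, map_smul, scl_mx, coeff_smul, coeff_smul, coeff_smul, mx_eq, coeff_monomial]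
    split_ifs with h
    · obtain ⟨h0, h1, h2⟩ := fs_inj.1 h
      rw [h0, h1, h2]; simp only [smul_eq_mul]; ring
    · simp
  | add p q hp hq => rw [map_add, coeff_add, hp, hq, coeff_add]; ring

def sclV (d : ℕ) (t : Fin 3 → ℂ) : V d →ₗ[ℂ] V d :=
  prj d ∘ₗ (scl t).toLinearMap ∘ₗ (V d).subtype

lemma sclV_powV (d : ℕ) (t a : Fin 3 → ℂ) : sclV d t (powV d a) = powV d (fun i => t i * a i) := by
  rw [powV_prj d (fun i => t i * a i), ← scl_lin, ← map_pow]; rfl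

lemma sclV_mV (d : ℕ) (t : Fin 3 → ℂ) (i j k : ℕ) :
    sclV d t (mV d i j k) = (t 0 ^ i * t 1 ^ j * t 2 ^ k) • mV d i j k := by
  by_cases h : i + j + k = d
  · have : sclV d t (mV d i j k) = prj d (scl t ((mV d i j k : V d) : MvP)) := rfl
    rw [this, mV_coe h, scl_mx, map_smul]; rfl
  · rw [mV_zero h]; simp

lemma br_eq (a b c : Fin 3 → ℂ) : br a b c =
    a 0 * b 1 * c 2 - a 0 * b 2 * c 1 - a 1 * b 0 * c 2 + a 1 * b 2 * c 0 + a 2 * b 0 * c 1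
      - a 2 * b 1 * c 0 := by
  rw [br, Matrix.det_fin_three]; simp

lemma br_scl (t a b c : Fin 3 → ℂ) :
    br (fun i => t i * a i) (fun i => t i * b i) (fun i => t i * c i)
      = t 0 * t 1 * t 2 * br a b c := by
  simp only [br_eq]; ring

lemma Icov_scl (t a b c e : Fin 3 → ℂ) :
    Icov (fun i => t i * a i) (fun i => t i * b i) (fun i => t i * c i) (fun i => t i * e i)
      = (t 0 * t 1 * t 2) ^ 4 * Icov a b c e := by
  simp only [Icov, br_scl]; ring

lemma cf_prod4_scl (t a b c e : Fin 3 → ℂ) (i j k : ℕ) :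
    cf 4 i j k (prod4 (fun i => t i * a i) (fun i => t i * b i) (fun i => t i * c i)
      (fun i => t i * e i)) = t 0 ^ i * t 1 ^ j * t 2 ^ k * cf 4 i j k (prod4 a b c e) := by
  rw [cf_apply, cf_apply, ← coeff_scl]
  simp only [prod4, map_mul, scl_lin]

section cleb
variable {n : ℕ} {Φ : MultilinearMap ℂ (fun _ : Fin 4 => V (3*n+1)) (V 4)}

lemma equivar (hΦ : IsClebschS n Φ) (t : Fin 3 → ℂ) (i j k : ℕ) (w x y z : V (3*n+1)) :
    cf 4 i j k (Φ ![sclV _ t w, sclV _ t x, sclV _ t y, sclV _ t z]) =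
     (t 0 ^ (4*n+i) * t 1 ^ (4*n+j) * t 2 ^ (4*n+k)) * cf 4 i j k (Φ ![w,x,y,z]) := by
  have key := mult_zero ((cf 4 i j k).compMultilinearMap (Φ.compLinearMap (fun _ => sclV _ t)) -
    (t 0 ^ (4*n+i) * t 1 ^ (4*n+j) * t 2 ^ (4*n+k)) • (cf 4 i j k).compMultilinearMap Φ) ?_ w x y z
  · have h2 : (fun i => sclV (3*n+1) t (![w,x,y,z] i))
        = ![sclV _ t w, sclV _ t x, sclV _ t y, sclV _ t z] := by
      ext i : 1; fin_cases i <;> rfl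
    simp only [sub_apply, smul_apply,
      LinearMap.compMultilinearMap_apply, MultilinearMap.compLinearMap_apply, h2, sub_eq_zero] at key
    simpa using key
  · intro a b c e
    have h2 : (fun i => sclV (3*n+1) t (![powV _ a,powV _ b,powV _ c,powV _ e] i))
        = ![powV _ (fun i => t i * a i), powV _ (fun i => t i * b i),
            powV _ (fun i => t i * c i), powV _ (fun i => t i * e i)] := by
      ext i : 1; fin_cases i <;> exact sclV_powV _ _ _
    simp only [sub_apply, smul_apply,
      LinearMap.compMultilinearMap_apply, MultilinearMap.compLinearMap_apply, h2, hΦ.2,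
      map_smul, cf_prod4_scl, Icov_scl, smul_eq_mul]
    rw [sub_eq_zero, mul_pow, ← pow_mul, mul_pow, mul_pow]
    ring

lemma weight (hΦ : IsClebschS n Φ) (i j k a0 a1 a2 b0 b1 b2 c0 c1 c2 e0 e1 e2 : ℕ)
    (h : ¬ (a0+b0+c0+e0 = 4*n+i ∧ a1+b1+c1+e1 = 4*n+j ∧ a2+b2+c2+e2 = 4*n+k)) :
    cf 4 i j k (Φ ![mV _ a0 a1 a2, mV _ b0 b1 b2, mV _ c0 c1 c2, mV _ e0 e1 e2]) = 0 := by
  have key : ∀ t : Fin 3 → ℂ, (t 0 ^ (a0+b0+c0+e0) * t 1 ^ (a1+b1+c1+e1) * t 2 ^ (a2+b2+c2+e2)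
      - t 0 ^ (4*n+i) * t 1 ^ (4*n+j) * t 2 ^ (4*n+k)) *
      cf 4 i j k (Φ ![mV _ a0 a1 a2, mV _ b0 b1 b2, mV _ c0 c1 c2, mV _ e0 e1 e2]) = 0 := by
    intro t
    rw [sub_mul, sub_eq_zero, ← equivar hΦ]
    simp only [sclV_mV, smul4, map_smul, smul_eq_mul, pow_add]
    ring
  have two : ∀ p q : ℕ, (2:ℂ)^p - 2^q = 0 → p = q := by
    intro p q hpq
    rw [sub_eq_zero] at hpq
    have : (2:ℕ)^p = 2^q := by exact_mod_cast hpq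
    exact Nat.pow_right_injective le_rfl this
  by_contra hne
  apply h
  refine ⟨?_, ?_, ?_⟩
  · have := (mul_eq_zero.1 (key ![2,1,1])).resolve_right hne
    apply two; simpa using this
  · have := (mul_eq_zero.1 (key ![1,2,1])).resolve_right hne
    apply two; simpa using this
  · have := (mul_eq_zero.1 (key ![1,1,2])).resolve_right hne
    apply two; simpa using this

end cleb

set_option linter.all false

/-! ### Coefficient computations -/

lemma pow_coeff0 (p : Polynomial ℂ) (n : ℕ) : (p ^ n).coeff 0 = p.coeff 0 ^ n := by
  simp [Polynomial.coeff_zero_eq_eval_zero]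

lemma pow_coeff1 (p : Polynomial ℂ) (n : ℕ) :
    (p ^ (n+1)).coeff 1 = (n+1) * p.coeff 0 ^ n * p.coeff 1 := by
  induction n with
  | zero => simp
  | succ k ih =>
    rw [pow_succ, Polynomial.mul_coeff_one, ih, pow_coeff0]; push_cast; ring

lemma mul_coeff2 (p q : Polynomial ℂ) :
    (p * q).coeff 2 = p.coeff 0 * q.coeff 2 + p.coeff 1 * q.coeff 1 + p.coeff 2 * q.coeff 0 := by
  rw [Polynomial.coeff_mul]
  simp [ Finset.Nat.antidiagonal_succ]
  ring

lemma pow_coeff2 (p : Polynomial ℂ) (n : ℕ) :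
    (p ^ (n+2)).coeff 2 = (n+2) * p.coeff 0 ^ (n+1) * p.coeff 2
      + (n+2) * (n+1) / 2 * p.coeff 0 ^ n * p.coeff 1 ^ 2 := by
  induction n with
  | zero => rw [pow_two, mul_coeff2]; simp; ring
  | succ k ih =>
    rw [pow_succ, mul_coeff2, ih, pow_coeff0, pow_coeff1]; push_cast; ring

/-- Taylor coefficients of (1-t)^m -/
def ac (m k : ℕ) : ℂ := (-1) ^ k * (m.choose k : ℂ)

lemma coeff_ac (m k : ℕ) : ((1 - Polynomial.X : Polynomial ℂ) ^ m).coeff k = ac m k := by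
  have : (1 - Polynomial.X : Polynomial ℂ) ^ m = ((1 + Polynomial.X) ^ m).comp (Polynomial.C (-1) * Polynomial.X) := by
    simp [sub_eq_add_neg]
  rw [this, Polynomial.comp_C_mul_X_coeff, Polynomial.coeff_one_add_X_pow, ac, mul_comm]

lemma uv_extract {d : ℕ} (φ : V d →ₗ[ℂ] ℂ) (m N : ℕ) (σ : ℂ) (k : ℕ → ℕ → ℂ)
    (h : ∀ u v, φ (powV d ![1,u,v]) = σ * (1-u)^m * (1-v)^m *
      ∑ i ∈ Finset.range N, ∑ j ∈ Finset.range N, k i j * u ^ i * v ^ j)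
    (q r : ℕ) (hqr : q + r ≤ d) (hq : q < N) (hr : r < N) :
    ((d.choose q * (d-q).choose r : ℕ) : ℂ) * φ (mV d (d-q-r) q r) =
      σ * ∑ x ∈ Finset.HasAntidiagonal.antidiagonal q, ac m x.1 * ∑ y ∈ Finset.HasAntidiagonal.antidiagonal r,
        ac m y.1 * k x.2 y.2 := by
  have hc : ∀ (w : ℕ → ℂ) (q : ℕ), q < N →
      ((1 - Polynomial.X : Polynomial ℂ) ^ m * ∑ i ∈ Finset.range N,
        Polynomial.C (w i) * Polynomial.X ^ i).coeff q
      = ∑ x ∈ Finset.HasAntidiagonal.antidiagonal q, ac m x.1 * w x.2 := by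
    intro w q hq
    rw [Polynomial.coeff_mul]
    refine Finset.sum_congr rfl fun x hx => ?_
    have hx2 : x.2 < N := by
      have := Finset.HasAntidiagonal.mem_antidiagonal.1 hx; omega
    rw [coeff_ac]
    simp [Polynomial.coeff_C_mul, Polynomial.coeff_X_pow, hx2]
  rw [ex120 φ
    (fun u => Polynomial.C (σ * (1-u)^m) * ((1 - Polynomial.X) ^ m * ∑ j ∈ Finset.range N,
        Polynomial.C (∑ i ∈ Finset.range N, k i j * u ^ i) * Polynomial.X ^ j))
    (Polynomial.C σ * ((1 - Polynomial.X) ^ m * ∑ i ∈ Finset.range N,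
        Polynomial.C (∑ y ∈ Finset.HasAntidiagonal.antidiagonal r, ac m y.1 * k i y.2) * Polynomial.X ^ i))
    ?_ q r hqr ?_]
  · rw [Polynomial.coeff_C_mul, hc _ _ hq]
  · intro u v
    rw [h]
    simp only [Polynomial.eval_mul, Polynomial.eval_C, Polynomial.eval_pow, Polynomial.eval_sub,
      Polynomial.eval_one, Polynomial.eval_X, Polynomial.eval_finsetSum]
    rw [Finset.sum_comm]
    simp only [Finset.sum_mul, mul_assoc]
  · intro u
    rw [Polynomial.coeff_C_mul, hc _ _ hr]
    simp only [Polynomial.eval_mul, Polynomial.eval_C, Polynomial.eval_pow, Polynomial.eval_sub,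
      Polynomial.eval_one, Polynomial.eval_X, Polynomial.eval_finsetSum]
    simp only [Finset.mul_sum, Finset.sum_mul]
    rw [Finset.sum_comm]
    refine Finset.sum_congr rfl fun x _ => Finset.sum_congr rfl fun y _ => ?_
    ring

lemma lin_mono (a : Fin 3 → ℂ) : lin a = ∑ p, monomial (Finsupp.single p 1) (a p) := by
  unfold lin
  refine Finset.sum_congr rfl fun p _ => ?_
  rw [C_mul_X_eq_monomial]

lemma cf_prod4 (i j k : ℕ) (a b c e : Fin 3 → ℂ) : cf 4 i j k (prod4 a b c e) =
    ∑ p, ∑ q, ∑ r, ∑ s, if (((if p = 0 then 1 else 0) + (if q = 0 then 1 else 0)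
      + (if r = 0 then 1 else 0) + (if s = 0 then 1 else 0) = i) ∧
      ((if p = 1 then 1 else 0) + (if q = 1 then 1 else 0)
      + (if r = 1 then 1 else 0) + (if s = 1 then 1 else 0) = j) ∧
      ((if p = 2 then 1 else 0) + (if q = 2 then 1 else 0)
      + (if r = 2 then 1 else 0) + (if s = 2 then 1 else 0) = k)) then a p * b q * c r * e s
      else 0 := by
  rw [cf_apply]
  simp only [prod4, lin_mono]
  rw [Finset.sum_mul_sum, Finset.sum_mul, Finset.sum_mul, coeff_sum]
  refine Finset.sum_congr rfl fun p _ => ?_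
  rw [Finset.sum_mul, Finset.sum_mul, coeff_sum]
  refine Finset.sum_congr rfl fun q _ => ?_
  rw [mul_assoc (monomial _ _ * monomial _ _), Finset.sum_mul_sum, Finset.mul_sum, coeff_sum]
  refine Finset.sum_congr rfl fun r _ => ?_
  rw [Finset.mul_sum, coeff_sum]
  refine Finset.sum_congr rfl fun s _ => ?_
  rw [← mul_assoc]
  simp only [monomial_mul, coeff_monomial]
  congr 1
  rw [fs_eta (Finsupp.single p 1 + Finsupp.single q 1 + Finsupp.single r 1 + Finsupp.single s 1),
    fs_inj]
  simp [Finsupp.single_apply]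

lemma Icov_BC (u v b c : ℂ) : Icov ![1,u,v] ![b,1,0] ![c,0,1] ![1,1,1] =
    -((1-u*b-v*c)*(1-v-b*(u-v))*(1-u+c*(u-v))*(1-b-c)) := by
  simp [Icov, br_eq]; ring

section cleb2
variable {n : ℕ} {Φ : MultilinearMap ℂ (fun _ : Fin 4 => V (3*n+1)) (V 4)}

lemma D_zero (hΦ : IsClebschS n Φ) (i j k a0 a1 a2 b0 b1 b2 c0 c1 c2 e0 e1 e2 : ℕ)
    (h0 : a0+b0+c0+e0 = 4*n+i) (h1 : a1+b1+c1+e1 = 4*n+j) (h2 : a2+b2+c2+e2 = 4*n+k)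
    (hz : cf 4 i j k (Φ ![mV _ a0 a1 a2, mV _ b0 b1 b2, mV _ c0 c1 c2, mV _ e0 e1 e2]) = 0) :
    cf 4 i j k (Φ ![mV _ a0 a1 a2, mV _ b0 b1 b2, mV _ c0 c1 c2, powV _ ![1,1,1]]) = 0 := by
  rw [← sl3_apply, powV_012]
  simp only [map_sum, map_smul]
  refine Finset.sum_eq_zero fun x _ => Finset.sum_eq_zero fun y _ => ?_
  rw [sl3_apply]
  by_cases hh : x = e0 ∧ y = e1 ∧ 3*n+1-x-y = e2
  · obtain ⟨rfl, rfl, h⟩ := hh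
    rw [h, hz]; simp
  · rw [weight hΦ]; simp
    omega

lemma extBC (hΦ : IsClebschS n Φ) (i j k : ℕ) (m : ℕ) (hm : n = m + 2)
    (e00 e10 e01 e11 : ℂ → ℂ → ℂ) 
    (he : ∀ u v b c, cf 4 i j k (prod4 ![1,u,v] ![b,1,0] ![c,0,1] ![1,1,1]) =
      e00 u v + b * e10 u v + c * e01 u v + b * c * e11 u v) (u v : ℂ) :
    ((3*n+1 : ℕ) : ℂ) ^ 2 * cf 4 i j k (Φ ![powV _ ![1,u,v], mV _ 1 (3*n) 0, mV _ 1 0 (3*n),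
      powV _ ![1,1,1]]) = (-1)^n * (1-u)^m * (1-v)^m * (
        (1-u)^2*(1-v)^2 * e11 u v
        + (m+2) * (1-u)^2*(1-v)*(-u*(1-v) - (u-v) - (1-v)) * e01 u v
        + (m+2) * (1-u)*(1-v)^2*(-v*(1-u) + (u-v) - (1-u)) * e10 u v
        + ((m+2)^2 * (1-u)*(1-v)*(-u*(1-v) - (u-v) - (1-v))*(-v*(1-u) + (u-v) - (1-u))
          - (m+2)*(u*v+1)*(1-u)^2*(1-v)^2) * e00 u v) := by
  have hB : ∀ c, ((3*n+1 : ℕ) : ℂ) * cf 4 i j k (Φ ![powV _ ![1,u,v], mV _ 1 (3*n) 0,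
      powV _ ![c,0,1], powV _ ![1,1,1]]) =
      (-1)^n * ((m+2) * ((1-v*c)*(1-v)*(1-u+c*(u-v))*(1-c))^(m+1) *
        ((1-u+c*(u-v)) * (-u*(1-v)*(1-c) - (1-v*c)*(u-v)*(1-c) - (1-v*c)*(1-v))) *
          (e00 u v + c * e01 u v)
        + ((1-v*c)*(1-v)*(1-u+c*(u-v))*(1-c))^(m+2) * (e10 u v + c * e11 u v)) := by
    intro c
    have := exB ((cf 4 i j k) ∘ₗ sl1 Φ (powV _ ![1,u,v]) (powV _ ![c,0,1]) (powV _ ![1,1,1]))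
      (Polynomial.C ((-1)^n) * (((Polynomial.C (1-v*c) - Polynomial.C u * Polynomial.X) *
        (Polynomial.C (1-v) - Polynomial.C (u-v) * Polynomial.X) * Polynomial.C (1-u+c*(u-v)) *
        (Polynomial.C (1-c) - Polynomial.X)) ^ (m+1+1) *
        (Polynomial.C (e00 u v + c * e01 u v) + Polynomial.C (e10 u v + c * e11 u v) *
          Polynomial.X))) ?_ (by omega)
    · simp only [LinearMap.comp_apply, sl1_apply, Nat.add_sub_cancel] at this
      rw [this]
      simp only [Polynomial.coeff_C_mul, Polynomial.mul_coeff_one, pow_coeff1, pow_coeff0,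
        Polynomial.mul_coeff_zero, Polynomial.coeff_add, Polynomial.coeff_sub,
        Polynomial.coeff_C_zero, Polynomial.coeff_X_zero, Polynomial.coeff_X_one,
        Polynomial.coeff_C_succ]
      simp only [mul_zero, zero_mul, sub_zero, add_zero, one_mul, mul_one, zero_add, zero_sub]
      generalize (-1:ℂ)^n = sg
      generalize 1-u+c*(u-v) = y1
      generalize 1-v = y2
      generalize 1-v*c = y3
      generalize 1-c = y4
      generalize u-v = y5
      generalize e00 u v + c * e01 u v = E0
      generalize e10 u v + c * e11 u v = E1
      rw [pow_succ _ (m+1)]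
      generalize (y3*y2*y1*y4)^(m+1) = z
      push_cast
      ring
    · intro b
      simp only [LinearMap.comp_apply, sl1_apply, hΦ.2, map_smul, smul_eq_mul, he, Icov_BC]
      rw [neg_pow, hm]
      simp only [Polynomial.eval_mul, Polynomial.eval_C, Polynomial.eval_pow, Polynomial.eval_sub,
        Polynomial.eval_add, Polynomial.eval_X]
      rw [show (1-u*b-v*c)*(1-v-b*(u-v))*(1-u+c*(u-v))*(1-b-c) =
        (1-v*c-u*b)*(1-v-(u-v)*b)*(1-u+c*(u-v))*(1-c-b) by ring, mul_assoc]
      congr 2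
      ring
  have := exC (((3*n+1 : ℕ) : ℂ) • (cf 4 i j k) ∘ₗ sl2 Φ (powV _ ![1,u,v]) (mV _ 1 (3*n) 0)
      (powV _ ![1,1,1]))
      (Polynomial.C ((-1)^n) * (Polynomial.C (m+2 : ℂ) * ((1-Polynomial.C v*Polynomial.X)*
        Polynomial.C (1-v)*(Polynomial.C (1-u)+Polynomial.X*Polynomial.C (u-v))*
          (1-Polynomial.X))^(m+1) *
        ((Polynomial.C (1-u)+Polynomial.X*Polynomial.C (u-v)) *
          (Polynomial.C (-u*(1-v))*(1-Polynomial.X) -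
            (1-Polynomial.C v*Polynomial.X)*Polynomial.C (u-v)*(1-Polynomial.X) -
              (1-Polynomial.C v*Polynomial.X)*Polynomial.C (1-v))) *
          (Polynomial.C (e00 u v) + Polynomial.X * Polynomial.C (e01 u v))
        + ((1-Polynomial.C v*Polynomial.X)*Polynomial.C (1-v)*
          (Polynomial.C (1-u)+Polynomial.X*Polynomial.C (u-v))*(1-Polynomial.X))^(m+1+1) *
            (Polynomial.C (e10 u v) + Polynomial.X * Polynomial.C (e11 u v)))) ?_ (by omega)
  · simp only [LinearMap.comp_apply, LinearMap.smul_apply, sl2_apply, Nat.add_sub_cancel,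
      smul_eq_mul] at this
    rw [sq, mul_assoc, this]
    simp only [Polynomial.coeff_C_mul, Polynomial.mul_coeff_one, pow_coeff1, pow_coeff0,
        Polynomial.mul_coeff_zero, Polynomial.coeff_add, Polynomial.coeff_sub,
        Polynomial.coeff_C_zero, Polynomial.coeff_X_zero, Polynomial.coeff_X_one,
        Polynomial.coeff_C_succ, Polynomial.coeff_one_zero, Polynomial.coeff_one,
        one_ne_zero, if_false, if_true]
    simp only [mul_zero, zero_mul, sub_zero, add_zero, one_mul, mul_one, mul_pow, pow_succ,
      zero_add, zero_sub]
    generalize 1-u = p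
    generalize 1-v = q
    generalize u-v = w
    generalize p^m = x
    generalize q^m = y
    generalize e00 u v = E0
    generalize e10 u v = E1
    generalize e01 u v = E2
    generalize e11 u v = E3
    generalize ((-1:ℂ)^n) = sg
    push_cast
    ring
  · intro c
    simp only [LinearMap.comp_apply, LinearMap.smul_apply, sl2_apply, smul_eq_mul]
    rw [hB]
    simp only [Polynomial.eval_mul, Polynomial.eval_C, Polynomial.eval_pow, Polynomial.eval_sub,
        Polynomial.eval_add, Polynomial.eval_X, Polynomial.eval_one]
end cleb2

/-! ### Rows -/

lemma ac0 (m : ℕ) : ac m 0 = 1 := by simp [ac]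
lemma ac1 (m : ℕ) : ac m 1 = -m := by simp [ac]
lemma ac2 (m : ℕ) : ac m 2 = m * (m-1) / 2 := by
  simp [ac, Nat.cast_choose_two]
lemma ac3 (m : ℕ) : ac m 3 = -(m * (m-1) * (m-2) / 6) := by
  have h : ∀ m : ℕ, ((m.choose 3 : ℕ) : ℂ) = m * (m-1) * (m-2) / 6 := by
    intro m
    induction m with
    | zero => simp
    | succ k ih =>
      rw [Nat.choose_succ_succ' k 2]
      push_cast
      rw [ih, Nat.cast_choose_two]; ring
  rw [ac, h]; ring

lemma row_gen {n : ℕ} {Φ : MultilinearMap ℂ (fun _ : Fin 4 => V (3*n+1)) (V 4)}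
    (hΦ : IsClebschS n Φ) (i q r m N : ℕ) (hm : n = m + 2) (hi : i + q + r = 4)
    (hq : q < N) (hr : r < N) (hqr : q + r ≤ 3*n+1)
    (e00 e10 e01 e11 : ℂ → ℂ → ℂ) (k : ℕ → ℕ → ℂ) (sg : ℂ) (val : ℕ) (hsg : sg ≠ 0)
    (hval : val ≠ 0)
    (he : ∀ u v b c, cf 4 i q r (prod4 ![1,u,v] ![b,1,0] ![c,0,1] ![1,1,1]) =
      e00 u v + b * e10 u v + c * e01 u v + b * c * e11 u v)
    (hk : ∀ u v : ℂ, ∑ i ∈ Finset.range N, ∑ j ∈ Finset.range N, k i j * u ^ i * v ^ j =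
      (1-u)^2*(1-v)^2 * e11 u v
        + (m+2) * (1-u)^2*(1-v)*(-u*(1-v) - (u-v) - (1-v)) * e01 u v
        + (m+2) * (1-u)*(1-v)^2*(-v*(1-u) + (u-v) - (1-u)) * e10 u v
        + ((m+2)^2 * (1-u)*(1-v)*(-u*(1-v) - (u-v) - (1-v))*(-v*(1-u) + (u-v) - (1-u))
          - (m+2)*(u*v+1)*(1-u)^2*(1-v)^2) * e00 u v)
    (hv : ∑ x ∈ Finset.HasAntidiagonal.antidiagonal q, ac m x.1 *
      ∑ y ∈ Finset.HasAntidiagonal.antidiagonal r, ac m y.1 * k x.2 y.2 = sg * (val : ℂ)) :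
    cf 4 i q r (Φ ![mV _ (3*n+1-q-r) q r, mV _ 1 (3*n) 0, mV _ 1 0 (3*n), mV _ (n+1) n n]) ≠ 0 := by
  intro hz
  have hz' := D_zero hΦ i q r _ _ _ _ _ _ _ _ _ _ _ _ (by omega) (by omega) (by omega) hz
  have key := uv_extract (((3*n+1 : ℕ) : ℂ)^2 • (cf 4 i q r) ∘ₗ sl0 Φ (mV _ 1 (3*n) 0)
      (mV _ 1 0 (3*n)) (powV _ ![1,1,1])) m N ((-1)^n) k ?_ q r hqr hq hr
  · rw [hv, LinearMap.smul_apply, LinearMap.comp_apply, sl0_apply, hz'] at key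
    simp [hsg, hval] at key
  · intro u v
    rw [hk, LinearMap.smul_apply, LinearMap.comp_apply, sl0_apply, smul_eq_mul]
    exact extBC hΦ i q r m hm e00 e10 e01 e11 he u v

def tb_00 (m : ℂ) : List (List ℂ) := [[1, -2, 1],
    [-2, 4, -2],
    [1, -2, 1]]

lemma row_00 {n : ℕ} {Φ : MultilinearMap ℂ (fun _ : Fin 4 => V (3*n+1)) (V 4)}
    (hn : 12 ≤ n) (hΦ : IsClebschS n Φ) :
    cf 4 4 0 0 (Φ ![mV _ (3*n+1-0-0) 0 0, mV _ 1 (3*n) 0, mV _ 1 0 (3*n), mV _ (n+1) n n]) ≠ 0 := by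
  obtain ⟨t, rfl⟩ := Nat.exists_eq_add_of_le' hn
  refine row_gen hΦ 4 0 0 (t+10) 3 rfl (by norm_num) (by norm_num) (by norm_num) (by omega)
    (fun u v => 0)
    (fun u v => 0)
    (fun u v => 0)
    (fun u v => 1)
    (fun i j => (((tb_00 ((t+10 : ℕ) : ℂ)).getD i []).getD j 0)) (1/1) (1) (by norm_num) (by positivity) ?_ ?_ ?_
  · intro u v b c
    rw [cf_prod4]
    simp [Fin.sum_univ_three]
    try ring
  · intro u v
    simp [Finset.sum_range_succ, tb_00]
    try ring
  · simp [Finset.Nat.antidiagonal_succ, tb_00, ac0, ac1, ac2, ac3]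
    try ring

def tb_01 (m : ℂ) : List (List ℂ) := [[-1 - m, -1, 5 + 3*m, -3 - 2*m],
    [4 + 3*m, -4 - 3*m, -4 - 3*m, 4 + 3*m],
    [-3 - 2*m, 5 + 3*m, -1, -1 - m],
    []]

lemma row_01 {n : ℕ} {Φ : MultilinearMap ℂ (fun _ : Fin 4 => V (3*n+1)) (V 4)}
    (hn : 12 ≤ n) (hΦ : IsClebschS n Φ) :
    cf 4 3 0 1 (Φ ![mV _ (3*n+1-0-1) 0 1, mV _ 1 (3*n) 0, mV _ 1 0 (3*n), mV _ (n+1) n n]) ≠ 0 := by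
  obtain ⟨t, rfl⟩ := Nat.exists_eq_add_of_le' hn
  refine row_gen hΦ 3 0 1 (t+10) 4 rfl (by norm_num) (by norm_num) (by norm_num) (by omega)
    (fun u v => 0)
    (fun u v => 1)
    (fun u v => 0)
    (fun u v => 1 + v)
    (fun i j => (((tb_01 ((t+10 : ℕ) : ℂ)).getD i []).getD j 0)) (1/1) (109 + 21*t + t^2) (by norm_num) (by positivity) ?_ ?_ ?_
  · intro u v b c
    rw [cf_prod4]
    simp [Fin.sum_univ_three]
    try ring
  · intro u v
    simp [Finset.sum_range_succ, tb_01]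
    try ring
  · simp [Finset.Nat.antidiagonal_succ, tb_01, ac0, ac1, ac2, ac3]
    try ring

def tb_02 (m : ℂ) : List (List ℂ) := [[-2 - m, -1 - m, 4 + 3*m, 3 + m, -4 - 2*m],
    [6 + 3*m, -2, -8 - 6*m, -2, 6 + 3*m],
    [-4 - 2*m, 3 + m, 4 + 3*m, -1 - m, -2 - m],
    [],
    []]

lemma row_02 {n : ℕ} {Φ : MultilinearMap ℂ (fun _ : Fin 4 => V (3*n+1)) (V 4)}
    (hn : 12 ≤ n) (hΦ : IsClebschS n Φ) :
    cf 4 2 0 2 (Φ ![mV _ (3*n+1-0-2) 0 2, mV _ 1 (3*n) 0, mV _ 1 0 (3*n), mV _ (n+1) n n]) ≠ 0 := by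
  obtain ⟨t, rfl⟩ := Nat.exists_eq_add_of_le' hn
  refine row_gen hΦ 2 0 2 (t+10) 5 rfl (by norm_num) (by norm_num) (by norm_num) (by omega)
    (fun u v => 0)
    (fun u v => 1 + v)
    (fun u v => 0)
    (fun u v => v)
    (fun i j => (((tb_02 ((t+10 : ℕ) : ℂ)).getD i []).getD j 0)) (-1/2) (792 + 270*t + 29*t^2 + t^3) (by norm_num) (by positivity) ?_ ?_ ?_
  · intro u v b c
    rw [cf_prod4]
    simp [Fin.sum_univ_three]
    try ring
  · intro u v
    simp [Finset.sum_range_succ, tb_02]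
    try ring
  · simp [Finset.Nat.antidiagonal_succ, tb_02, ac0, ac1, ac2, ac3]
    try ring

def tb_03 (m : ℂ) : List (List ℂ) := [[0, -2 - m, 0, 6 + 3*m, -4 - 2*m],
    [0, 6 + 3*m, -6 - 3*m, -6 - 3*m, 6 + 3*m],
    [0, -4 - 2*m, 6 + 3*m, 0, -2 - m],
    [],
    []]

lemma row_03 {n : ℕ} {Φ : MultilinearMap ℂ (fun _ : Fin 4 => V (3*n+1)) (V 4)}
    (hn : 12 ≤ n) (hΦ : IsClebschS n Φ) :
    cf 4 1 0 3 (Φ ![mV _ (3*n+1-0-3) 0 3, mV _ 1 (3*n) 0, mV _ 1 0 (3*n), mV _ (n+1) n n]) ≠ 0 := by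
  obtain ⟨t, rfl⟩ := Nat.exists_eq_add_of_le' hn
  refine row_gen hΦ 1 0 3 (t+10) 5 rfl (by norm_num) (by norm_num) (by norm_num) (by omega)
    (fun u v => 0)
    (fun u v => v)
    (fun u v => 0)
    (fun u v => 0)
    (fun i j => (((tb_03 ((t+10 : ℕ) : ℂ)).getD i []).getD j 0)) (-1/2) (1008 + 312*t + 31*t^2 + t^3) (by norm_num) (by positivity) ?_ ?_ ?_
  · intro u v b c
    rw [cf_prod4]
    simp [Fin.sum_univ_three]
    try ring
  · intro u v
    simp [Finset.sum_range_succ, tb_03]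
    try ring
  · simp [Finset.Nat.antidiagonal_succ, tb_03, ac0, ac1, ac2, ac3]
    try ring

def tb_10 (m : ℂ) : List (List ℂ) := [[-1 - m, 4 + 3*m, -3 - 2*m],
    [-1, -4 - 3*m, 5 + 3*m],
    [5 + 3*m, -4 - 3*m, -1],
    [-3 - 2*m, 4 + 3*m, -1 - m]]

lemma row_10 {n : ℕ} {Φ : MultilinearMap ℂ (fun _ : Fin 4 => V (3*n+1)) (V 4)}
    (hn : 12 ≤ n) (hΦ : IsClebschS n Φ) :
    cf 4 3 1 0 (Φ ![mV _ (3*n+1-1-0) 1 0, mV _ 1 (3*n) 0, mV _ 1 0 (3*n), mV _ (n+1) n n]) ≠ 0 := by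
  obtain ⟨t, rfl⟩ := Nat.exists_eq_add_of_le' hn
  refine row_gen hΦ 3 1 0 (t+10) 4 rfl (by norm_num) (by norm_num) (by norm_num) (by omega)
    (fun u v => 0)
    (fun u v => 0)
    (fun u v => 1)
    (fun u v => 1 + u)
    (fun i j => (((tb_10 ((t+10 : ℕ) : ℂ)).getD i []).getD j 0)) (1/1) (109 + 21*t + t^2) (by norm_num) (by positivity) ?_ ?_ ?_
  · intro u v b c
    rw [cf_prod4]
    simp [Fin.sum_univ_three]
    try ring
  · intro u v
    simp [Finset.sum_range_succ, tb_10]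
    try ring
  · simp [Finset.Nat.antidiagonal_succ, tb_10, ac0, ac1, ac2, ac3]
    try ring

def tb_11 (m : ℂ) : List (List ℂ) := [[-2 + m + m^2, 5 - m^2, -12 - 13*m - 4*m^2, 9 + 12*m + 4*m^2],
    [5 - m^2, 2 + 17*m + 7*m^2, 5 - 4*m - 2*m^2, -12 - 13*m - 4*m^2],
    [-12 - 13*m - 4*m^2, 5 - 4*m - 2*m^2, 2 + 17*m + 7*m^2, 5 - m^2],
    [9 + 12*m + 4*m^2, -12 - 13*m - 4*m^2, 5 - m^2, -2 + m + m^2]]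

lemma row_11 {n : ℕ} {Φ : MultilinearMap ℂ (fun _ : Fin 4 => V (3*n+1)) (V 4)}
    (hn : 12 ≤ n) (hΦ : IsClebschS n Φ) :
    cf 4 2 1 1 (Φ ![mV _ (3*n+1-1-1) 1 1, mV _ 1 (3*n) 0, mV _ 1 0 (3*n), mV _ (n+1) n n]) ≠ 0 := by
  obtain ⟨t, rfl⟩ := Nat.exists_eq_add_of_le' hn
  refine row_gen hΦ 2 1 1 (t+10) 4 rfl (by norm_num) (by norm_num) (by norm_num) (by omega)
    (fun u v => 1)
    (fun u v => 1 + u)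
    (fun u v => 1 + v)
    (fun u v => v + u)
    (fun i j => (((tb_11 ((t+10 : ℕ) : ℂ)).getD i []).getD j 0)) (1/1) (13572 + 5007*t + 695*t^2 + 43*t^3 + t^4) (by norm_num) (by positivity) ?_ ?_ ?_
  · intro u v b c
    rw [cf_prod4]
    simp [Fin.sum_univ_three]
    try ring
  · intro u v
    simp [Finset.sum_range_succ, tb_11]
    try ring
  · simp [Finset.Nat.antidiagonal_succ, tb_11, ac0, ac1, ac2, ac3]
    try ring

def tb_12 (m : ℂ) : List (List ℂ) := [[2 + 3*m + m^2, -2 - m, -12 - 16*m - 5*m^2, 0, 12 + 14*m + 4*m^2],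
    [-2 - 3*m - m^2, 24 + 24*m + 6*m^2, 12 + 16*m + 5*m^2, -22 - 23*m - 6*m^2, -12 - 14*m - 4*m^2],
    [-12 - 14*m - 4*m^2, -22 - 23*m - 6*m^2, 12 + 16*m + 5*m^2, 24 + 24*m + 6*m^2, -2 - 3*m - m^2],
    [12 + 14*m + 4*m^2, 0, -12 - 16*m - 5*m^2, -2 - m, 2 + 3*m + m^2],
    []]

lemma row_12 {n : ℕ} {Φ : MultilinearMap ℂ (fun _ : Fin 4 => V (3*n+1)) (V 4)}
    (hn : 12 ≤ n) (hΦ : IsClebschS n Φ) :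
    cf 4 1 1 2 (Φ ![mV _ (3*n+1-1-2) 1 2, mV _ 1 (3*n) 0, mV _ 1 0 (3*n), mV _ (n+1) n n]) ≠ 0 := by
  obtain ⟨t, rfl⟩ := Nat.exists_eq_add_of_le' hn
  refine row_gen hΦ 1 1 2 (t+10) 5 rfl (by norm_num) (by norm_num) (by norm_num) (by omega)
    (fun u v => 1 + v)
    (fun u v => v + u)
    (fun u v => v)
    (fun u v => 0)
    (fun i j => (((tb_12 ((t+10 : ℕ) : ℂ)).getD i []).getD j 0)) (-1/2) (135576 + 63630*t + 11957*t^2 + 1125*t^3 + 53*t^4 + t^5) (by norm_num) (by positivity) ?_ ?_ ?_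
  · intro u v b c
    rw [cf_prod4]
    simp [Fin.sum_univ_three]
    try ring
  · intro u v
    simp [Finset.sum_range_succ, tb_12]
    try ring
  · simp [Finset.Nat.antidiagonal_succ, tb_12, ac0, ac1, ac2, ac3]
    try ring

def tb_13 (m : ℂ) : List (List ℂ) := [[0, 2 + 3*m + m^2, -2*m - m^2, -18 - 17*m - 4*m^2, 16 + 16*m + 4*m^2],
    [0, -2*m - m^2, 18 + 23*m + 7*m^2, -4*m - 2*m^2, -18 - 17*m - 4*m^2],
    [0, -18 - 17*m - 4*m^2, -4*m - 2*m^2, 18 + 23*m + 7*m^2, -2*m - m^2],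
    [0, 16 + 16*m + 4*m^2, -18 - 17*m - 4*m^2, -2*m - m^2, 2 + 3*m + m^2],
    []]

lemma row_13 {n : ℕ} {Φ : MultilinearMap ℂ (fun _ : Fin 4 => V (3*n+1)) (V 4)}
    (hn : 12 ≤ n) (hΦ : IsClebschS n Φ) :
    cf 4 0 1 3 (Φ ![mV _ (3*n+1-1-3) 1 3, mV _ 1 (3*n) 0, mV _ 1 0 (3*n), mV _ (n+1) n n]) ≠ 0 := by
  obtain ⟨t, rfl⟩ := Nat.exists_eq_add_of_le' hn
  refine row_gen hΦ 0 1 3 (t+10) 5 rfl (by norm_num) (by norm_num) (by norm_num) (by omega)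
    (fun u v => v)
    (fun u v => 0)
    (fun u v => 0)
    (fun u v => 0)
    (fun i j => (((tb_13 ((t+10 : ℕ) : ℂ)).getD i []).getD j 0)) (-1/2) (161280 + 73248*t + 13312*t^2 + 1210*t^3 + 55*t^4 + t^5) (by norm_num) (by positivity) ?_ ?_ ?_
  · intro u v b c
    rw [cf_prod4]
    simp [Fin.sum_univ_three]
    try ring
  · intro u v
    simp [Finset.sum_range_succ, tb_13]
    try ring
  · simp [Finset.Nat.antidiagonal_succ, tb_13, ac0, ac1, ac2, ac3]
    try ring

def tb_20 (m : ℂ) : List (List ℂ) := [[-2 - m, 6 + 3*m, -4 - 2*m],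
    [-1 - m, -2, 3 + m],
    [4 + 3*m, -8 - 6*m, 4 + 3*m],
    [3 + m, -2, -1 - m],
    [-4 - 2*m, 6 + 3*m, -2 - m]]

lemma row_20 {n : ℕ} {Φ : MultilinearMap ℂ (fun _ : Fin 4 => V (3*n+1)) (V 4)}
    (hn : 12 ≤ n) (hΦ : IsClebschS n Φ) :
    cf 4 2 2 0 (Φ ![mV _ (3*n+1-2-0) 2 0, mV _ 1 (3*n) 0, mV _ 1 0 (3*n), mV _ (n+1) n n]) ≠ 0 := by
  obtain ⟨t, rfl⟩ := Nat.exists_eq_add_of_le' hn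
  refine row_gen hΦ 2 2 0 (t+10) 5 rfl (by norm_num) (by norm_num) (by norm_num) (by omega)
    (fun u v => 0)
    (fun u v => 0)
    (fun u v => 1 + u)
    (fun u v => u)
    (fun i j => (((tb_20 ((t+10 : ℕ) : ℂ)).getD i []).getD j 0)) (-1/2) (792 + 270*t + 29*t^2 + t^3) (by norm_num) (by positivity) ?_ ?_ ?_
  · intro u v b c
    rw [cf_prod4]
    simp [Fin.sum_univ_three]
    try ring
  · intro u v
    simp [Finset.sum_range_succ, tb_20]
    try ring
  · simp [Finset.Nat.antidiagonal_succ, tb_20, ac0, ac1, ac2, ac3]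
    try ring

def tb_21 (m : ℂ) : List (List ℂ) := [[2 + 3*m + m^2, -2 - 3*m - m^2, -12 - 14*m - 4*m^2, 12 + 14*m + 4*m^2],
    [-2 - m, 24 + 24*m + 6*m^2, -22 - 23*m - 6*m^2],
    [-12 - 16*m - 5*m^2, 12 + 16*m + 5*m^2, 12 + 16*m + 5*m^2, -12 - 16*m - 5*m^2],
    [0, -22 - 23*m - 6*m^2, 24 + 24*m + 6*m^2, -2 - m],
    [12 + 14*m + 4*m^2, -12 - 14*m - 4*m^2, -2 - 3*m - m^2, 2 + 3*m + m^2]]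

lemma row_21 {n : ℕ} {Φ : MultilinearMap ℂ (fun _ : Fin 4 => V (3*n+1)) (V 4)}
    (hn : 12 ≤ n) (hΦ : IsClebschS n Φ) :
    cf 4 1 2 1 (Φ ![mV _ (3*n+1-2-1) 2 1, mV _ 1 (3*n) 0, mV _ 1 0 (3*n), mV _ (n+1) n n]) ≠ 0 := by
  obtain ⟨t, rfl⟩ := Nat.exists_eq_add_of_le' hn
  refine row_gen hΦ 1 2 1 (t+10) 5 rfl (by norm_num) (by norm_num) (by norm_num) (by omega)
    (fun u v => 1 + u)
    (fun u v => u)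
    (fun u v => v + u)
    (fun u v => 0)
    (fun i j => (((tb_21 ((t+10 : ℕ) : ℂ)).getD i []).getD j 0)) (-1/2) (135576 + 63630*t + 11957*t^2 + 1125*t^3 + 53*t^4 + t^5) (by norm_num) (by positivity) ?_ ?_ ?_
  · intro u v b c
    rw [cf_prod4]
    simp [Fin.sum_univ_three]
    try ring
  · intro u v
    simp [Finset.sum_range_succ, tb_21]
    try ring
  · simp [Finset.Nat.antidiagonal_succ, tb_21, ac0, ac1, ac2, ac3]
    try ring

def tb_22 (m : ℂ) : List (List ℂ) := [[0, 2 + 3*m + m^2, -2*m - m^2, -18 - 17*m - 4*m^2, 16 + 16*m + 4*m^2],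
    [2 + 3*m + m^2, -4*m - 2*m^2, 6*m + 3*m^2, 16 + 12*m + 2*m^2, -18 - 17*m - 4*m^2],
    [-2*m - m^2, 6*m + 3*m^2, -8*m - 4*m^2, 6*m + 3*m^2, -2*m - m^2],
    [-18 - 17*m - 4*m^2, 16 + 12*m + 2*m^2, 6*m + 3*m^2, -4*m - 2*m^2, 2 + 3*m + m^2],
    [16 + 16*m + 4*m^2, -18 - 17*m - 4*m^2, -2*m - m^2, 2 + 3*m + m^2]]

lemma row_22 {n : ℕ} {Φ : MultilinearMap ℂ (fun _ : Fin 4 => V (3*n+1)) (V 4)}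
    (hn : 12 ≤ n) (hΦ : IsClebschS n Φ) :
    cf 4 0 2 2 (Φ ![mV _ (3*n+1-2-2) 2 2, mV _ 1 (3*n) 0, mV _ 1 0 (3*n), mV _ (n+1) n n]) ≠ 0 := by
  obtain ⟨t, rfl⟩ := Nat.exists_eq_add_of_le' hn
  refine row_gen hΦ 0 2 2 (t+10) 5 rfl (by norm_num) (by norm_num) (by norm_num) (by omega)
    (fun u v => v + u)
    (fun u v => 0)
    (fun u v => 0)
    (fun u v => 0)
    (fun i j => (((tb_22 ((t+10 : ℕ) : ℂ)).getD i []).getD j 0)) (-1/1) (161280 + 73248*t + 13312*t^2 + 1210*t^3 + 55*t^4 + t^5) (by norm_num) (by positivity) ?_ ?_ ?_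
  · intro u v b c
    rw [cf_prod4]
    simp [Fin.sum_univ_three]
    try ring
  · intro u v
    simp [Finset.sum_range_succ, tb_22]
    try ring
  · simp [Finset.Nat.antidiagonal_succ, tb_22, ac0, ac1, ac2, ac3]
    try ring

def tb_30 (m : ℂ) : List (List ℂ) := [[],
    [-2 - m, 6 + 3*m, -4 - 2*m],
    [0, -6 - 3*m, 6 + 3*m],
    [6 + 3*m, -6 - 3*m],
    [-4 - 2*m, 6 + 3*m, -2 - m]]

lemma row_30 {n : ℕ} {Φ : MultilinearMap ℂ (fun _ : Fin 4 => V (3*n+1)) (V 4)}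
    (hn : 12 ≤ n) (hΦ : IsClebschS n Φ) :
    cf 4 1 3 0 (Φ ![mV _ (3*n+1-3-0) 3 0, mV _ 1 (3*n) 0, mV _ 1 0 (3*n), mV _ (n+1) n n]) ≠ 0 := by
  obtain ⟨t, rfl⟩ := Nat.exists_eq_add_of_le' hn
  refine row_gen hΦ 1 3 0 (t+10) 5 rfl (by norm_num) (by norm_num) (by norm_num) (by omega)
    (fun u v => 0)
    (fun u v => 0)
    (fun u v => u)
    (fun u v => 0)
    (fun i j => (((tb_30 ((t+10 : ℕ) : ℂ)).getD i []).getD j 0)) (-1/2) (1008 + 312*t + 31*t^2 + t^3) (by norm_num) (by positivity) ?_ ?_ ?_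
  · intro u v b c
    rw [cf_prod4]
    simp [Fin.sum_univ_three]
    try ring
  · intro u v
    simp [Finset.sum_range_succ, tb_30]
    try ring
  · simp [Finset.Nat.antidiagonal_succ, tb_30, ac0, ac1, ac2, ac3]
    try ring

def tb_31 (m : ℂ) : List (List ℂ) := [[],
    [2 + 3*m + m^2, -2*m - m^2, -18 - 17*m - 4*m^2, 16 + 16*m + 4*m^2],
    [-2*m - m^2, 18 + 23*m + 7*m^2, -4*m - 2*m^2, -18 - 17*m - 4*m^2],
    [-18 - 17*m - 4*m^2, -4*m - 2*m^2, 18 + 23*m + 7*m^2, -2*m - m^2],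
    [16 + 16*m + 4*m^2, -18 - 17*m - 4*m^2, -2*m - m^2, 2 + 3*m + m^2]]

lemma row_31 {n : ℕ} {Φ : MultilinearMap ℂ (fun _ : Fin 4 => V (3*n+1)) (V 4)}
    (hn : 12 ≤ n) (hΦ : IsClebschS n Φ) :
    cf 4 0 3 1 (Φ ![mV _ (3*n+1-3-1) 3 1, mV _ 1 (3*n) 0, mV _ 1 0 (3*n), mV _ (n+1) n n]) ≠ 0 := by
  obtain ⟨t, rfl⟩ := Nat.exists_eq_add_of_le' hn
  refine row_gen hΦ 0 3 1 (t+10) 5 rfl (by norm_num) (by norm_num) (by norm_num) (by omega)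
    (fun u v => u)
    (fun u v => 0)
    (fun u v => 0)
    (fun u v => 0)
    (fun i j => (((tb_31 ((t+10 : ℕ) : ℂ)).getD i []).getD j 0)) (-1/2) (161280 + 73248*t + 13312*t^2 + 1210*t^3 + 55*t^4 + t^5) (by norm_num) (by positivity) ?_ ?_ ?_
  · intro u v b c
    rw [cf_prod4]
    simp [Fin.sum_univ_three]
    try ring
  · intro u v
    simp [Finset.sum_range_succ, tb_31]
    try ring
  · simp [Finset.Nat.antidiagonal_succ, tb_31, ac0, ac1, ac2, ac3]
    try ring

def tb_c (m : ℂ) : List (List ℂ) := [[],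
    [-6 - 11*m - 6*m^2 - m^3, -36 - 30*m - 6*m^2, 180 + 189*m + 64*m^2 + 7*m^3, -48 - 52*m - 18*m^2 - 2*m^3, -270 - 288*m - 102*m^2 - 12*m^3, 180 + 192*m + 68*m^2 + 8*m^3],
    [18 + 33*m + 18*m^2 + 3*m^3, -108 - 135*m - 60*m^2 - 9*m^3, -348 - 383*m - 134*m^2 - 15*m^3, 648 + 729*m + 270*m^2 + 33*m^3, 90 + 66*m + 12*m^2, -300 - 310*m - 106*m^2 - 12*m^3],
    [108 + 96*m + 26*m^2 + 2*m^3, 324 + 387*m + 156*m^2 + 21*m^3, -432 - 483*m - 182*m^2 - 23*m^3, -432 - 483*m - 182*m^2 - 23*m^3, 324 + 387*m + 156*m^2 + 21*m^3, 108 + 96*m + 26*m^2 + 2*m^3],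
    [-300 - 310*m - 106*m^2 - 12*m^3, 90 + 66*m + 12*m^2, 648 + 729*m + 270*m^2 + 33*m^3, -348 - 383*m - 134*m^2 - 15*m^3, -108 - 135*m - 60*m^2 - 9*m^3, 18 + 33*m + 18*m^2 + 3*m^3],
    [180 + 192*m + 68*m^2 + 8*m^3, -270 - 288*m - 102*m^2 - 12*m^3, -48 - 52*m - 18*m^2 - 2*m^3, 180 + 189*m + 64*m^2 + 7*m^3, -36 - 30*m - 6*m^2, -6 - 11*m - 6*m^2 - m^3]]

/-! ### Corner rows -/

def cQ (u v b : ℂ) : Polynomial ℂ :=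
  (Polynomial.C (1-u*b) - Polynomial.C v * Polynomial.X) * Polynomial.C (1-v-b*(u-v)) *
    (Polynomial.C (1-u) + Polynomial.X * Polynomial.C (u-v)) * (Polynomial.C (1-b) - Polynomial.X)

def c0 (u v b : ℂ) : ℂ := (1-u*b)*(1-v-b*(u-v))*(1-u)*(1-b)
def c1 (u v b : ℂ) : ℂ := (1-v-b*(u-v)) *
  (-v*(1-u)*(1-b) + (1-u*b)*(u-v)*(1-b) - (1-u*b)*(1-u))
def c2 (u v b : ℂ) : ℂ := (1-v-b*(u-v)) * (-v*(u-v)*(1-b) + v*(1-u) - (1-u*b)*(u-v))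

lemma alg1 (m : ℕ) (u v b : ℂ) : (cQ u v b ^ (m+3)).coeff 2 =
    (m+3) * c0 u v b ^ (m+2) * c2 u v b + (m+3)*(m+2)/2 * c0 u v b ^ (m+1) * c1 u v b ^ 2 := by
  have h0 : (cQ u v b).coeff 0 = c0 u v b := by
    simp [cQ, c0, Polynomial.mul_coeff_zero]
  have h1 : (cQ u v b).coeff 1 = c1 u v b := by
    simp only [cQ, c1, Polynomial.mul_coeff_zero, Polynomial.mul_coeff_one, Polynomial.coeff_add,
      Polynomial.coeff_sub,
        Polynomial.coeff_C_zero, Polynomial.coeff_X_zero, Polynomial.coeff_X_one,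
        Polynomial.coeff_C_succ]
    ring
  have h2 : (cQ u v b).coeff 2 = c2 u v b := by
    have hX : (Polynomial.X : Polynomial ℂ).coeff 2 = 0 := by simp [Polynomial.coeff_X]
    simp only [cQ, c2, mul_coeff2, Polynomial.mul_coeff_zero, Polynomial.mul_coeff_one,
      Polynomial.coeff_add, Polynomial.coeff_sub,
        Polynomial.coeff_C_zero, Polynomial.coeff_X_zero, Polynomial.coeff_X_one,
        Polynomial.coeff_C_succ, hX, Polynomial.coeff_C_ne_zero (two_ne_zero)]
    ring
  rw [show m + 3 = m + 1 + 2 by ring, pow_coeff2, h0, h1, h2]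
  push_cast; ring

def cP0 (u v : ℂ) : Polynomial ℂ :=
  (1-Polynomial.C u*Polynomial.X)*(Polynomial.C (1-v)-Polynomial.X*Polynomial.C (u-v))*
    Polynomial.C (1-u)*(1-Polynomial.X)
def cP1 (u v : ℂ) : Polynomial ℂ := (Polynomial.C (1-v)-Polynomial.X*Polynomial.C (u-v)) *
  (Polynomial.C (-v*(1-u))*(1-Polynomial.X)
    + (1-Polynomial.C u*Polynomial.X)*Polynomial.C (u-v)*(1-Polynomial.X)
    - (1-Polynomial.C u*Polynomial.X)*Polynomial.C (1-u))
def cP2 (u v : ℂ) : Polynomial ℂ := (Polynomial.C (1-v)-Polynomial.X*Polynomial.C (u-v)) *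
  (Polynomial.C (-v*(u-v))*(1-Polynomial.X) + Polynomial.C (v*(1-u))
    - (1-Polynomial.C u*Polynomial.X)*Polynomial.C (u-v))

def cR (m : ℕ) (u v : ℂ) : Polynomial ℂ :=
  Polynomial.C (m+3 : ℂ) * cP0 u v ^ (m+2) * cP2 u v
    + Polynomial.C ((m+3)*(m+2)/2 : ℂ) * cP0 u v ^ (m+1) * cP1 u v ^ 2

lemma cR_eval (m : ℕ) (u v b : ℂ) : (cR m u v).eval b = (cQ u v b ^ (m+3)).coeff 2 := by
  rw [alg1]
  have h0 : (cP0 u v).eval b = c0 u v b := by simp [cP0, c0]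
  have h1 : (cP1 u v).eval b = c1 u v b := by simp [cP1, c1]
  have h2 : (cP2 u v).eval b = c2 u v b := by simp [cP2, c2]
  simp only [cR, Polynomial.eval_add, Polynomial.eval_mul, Polynomial.eval_pow, Polynomial.eval_C,
    h0, h1, h2]

set_option maxRecDepth 20000 in
set_option maxHeartbeats 2000000 in
lemma cR_coeff (m : ℕ) (u v : ℂ) : u * (cR m u v).coeff 1 = (1/2) * (1-u)^m * (1-v)^m *
    ∑ i ∈ Finset.range 6, ∑ j ∈ Finset.range 6,
      (((tb_c (m : ℂ)).getD i []).getD j 0) * u ^ i * v ^ j := by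
  have a0 : (cP0 u v).coeff 0 = (1-v)*(1-u) := by simp [cP0, Polynomial.mul_coeff_zero]
  have a1 : (cP0 u v).coeff 1 = (1-u)*(-(u-v)-(1-v)*u-(1-v)) := by
    simp [cP0, Polynomial.mul_coeff_zero, Polynomial.mul_coeff_one, Polynomial.coeff_one]
    ring
  have b0 : (cP1 u v).coeff 0 = (1-v)*(-(v*(1-u))+(u-v)-(1-u)) := by
    simp [cP1, Polynomial.mul_coeff_zero]
  have b1 : (cP1 u v).coeff 1 = -(u-v)*(-(v*(1-u))+(u-v)-(1-u))
      + (1-v)*(v*(1-u)-u*(u-v)-(u-v)+u*(1-u)) := by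
    simp [cP1, Polynomial.mul_coeff_zero, Polynomial.mul_coeff_one, Polynomial.coeff_one]
    ring
  have d0 : (cP2 u v).coeff 0 = (1-v)*(-(v*(u-v))+v*(1-u)-(u-v)) := by
    simp [cP2, Polynomial.mul_coeff_zero]
  have d1 : (cP2 u v).coeff 1 = -(u-v)*(-(v*(u-v))+v*(1-u)-(u-v))
      + (1-v)*(v*(u-v)+u*(u-v)) := by
    simp [cP2, Polynomial.mul_coeff_zero, Polynomial.mul_coeff_one, Polynomial.coeff_one]
    ring
  have hp : (cR m u v).coeff 1 = (m+3) * ((m+2) * (cP0 u v).coeff 0 ^ (m+1) * (cP0 u v).coeff 1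
      * (cP2 u v).coeff 0 + (cP0 u v).coeff 0 ^ (m+2) * (cP2 u v).coeff 1)
      + (m+3)*(m+2)/2 * ((m+1) * (cP0 u v).coeff 0 ^ m * (cP0 u v).coeff 1 * (cP1 u v).coeff 0 ^ 2
        + (cP0 u v).coeff 0 ^ (m+1) * (2 * (cP1 u v).coeff 0 * (cP1 u v).coeff 1)) := by
    have e1 := pow_coeff1 (cP0 u v) (m+1)
    have e2 := pow_coeff1 (cP0 u v) m
    have e3 := pow_coeff1 (cP1 u v) 1
    have e4 : m + 2 = m + 1 + 1 := rfl
    have e5 : (cP1 u v)^2 = (cP1 u v)^(1+1) := rfl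
    rw [cR, Polynomial.coeff_add, mul_assoc, mul_assoc, Polynomial.coeff_C_mul,
      Polynomial.coeff_C_mul, Polynomial.mul_coeff_one, Polynomial.mul_coeff_one, e4, e5, e1, e2,
      e3, pow_coeff0, pow_coeff0, pow_coeff0]
    push_cast; ring
  rw [hp, a0, a1, b0, b1, d0, d1, pow_add _ m 1, pow_add _ m 2, mul_pow _ _ m]
  generalize (1-u)^m = x
  generalize (1-v)^m = y
  simp only [Finset.sum_range_succ, Finset.sum_range_zero, tb_c, List.getD_cons_zero,
    List.getD_cons_succ, List.getD_nil]
  ring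

lemma tb_c_val (t : ℕ) : ∑ x ∈ Finset.HasAntidiagonal.antidiagonal 3, ac (t+9) x.1 *
      ∑ y ∈ Finset.HasAntidiagonal.antidiagonal 2, ac (t+9) y.1 *
        (((tb_c ((t+9 : ℕ) : ℂ)).getD x.2 []).getD y.2 0) =
    (-1/4) * ((13039488 + 8753760*t + 2531544*t^2 + 407546*t^3 + 39359*t^4 + 2277*t^5 + 73*t^6 + t^7 : ℕ) : ℂ) := by
  simp [Finset.Nat.antidiagonal_succ, tb_c, ac0, ac1, ac2, ac3]
  ring

lemma tb_c_val' (t : ℕ) : ∑ x ∈ Finset.HasAntidiagonal.antidiagonal 2, ac (t+9) x.1 *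
      ∑ y ∈ Finset.HasAntidiagonal.antidiagonal 3, ac (t+9) y.1 *
        (((tb_c ((t+9 : ℕ) : ℂ)).getD y.2 []).getD x.2 0) =
    (-1/4) * ((13039488 + 8753760*t + 2531544*t^2 + 407546*t^3 + 39359*t^4 + 2277*t^5 + 73*t^6 + t^7 : ℕ) : ℂ) := by
  simp [Finset.Nat.antidiagonal_succ, tb_c, ac0, ac1, ac2, ac3]
  ring

lemma Icov_BE (u v b s t : ℂ) : Icov ![1,u,v] ![b,1,0] ![s,t,1] ![1,1,1] =
    -((1-u*b+v*(b*t-s))*(1-v-b*(u-v))*(1-u+s*(u-v)+t*(v-1))*(1-b-s+b*t)) := by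
  simp [Icov, br_eq]; ring

lemma Icov_CE (u v c s t : ℂ) : Icov ![1,u,v] ![s,1,t] ![c,0,1] ![1,1,1] =
    -((1-v*c+u*(t*c-s))*(1-u-c*(v-u))*(1-v+s*(v-u)+t*(u-1))*(1-c-s+c*t)) := by
  simp [Icov, br_eq]; ring

/-- the polynomial in t -/
def tQ (u v b s : ℂ) : Polynomial ℂ :=
  (Polynomial.C (1-u*b-v*s) + Polynomial.C (v*b)*Polynomial.X)*Polynomial.C (1-v-b*(u-v))*
    (Polynomial.C (1-u+s*(u-v))+Polynomial.C (v-1)*Polynomial.X)*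
      (Polynomial.C (1-b-s)+Polynomial.C b*Polynomial.X)

lemma tQ_eval (u v b s t : ℂ) : (tQ u v b s).eval t =
    (1-u*b+v*(b*t-s))*(1-v-b*(u-v))*(1-u+s*(u-v)+t*(v-1))*(1-b-s+b*t) := by
  simp only [tQ, Polynomial.eval_add, Polynomial.eval_mul, Polynomial.eval_C, Polynomial.eval_X]
  rw [show 1-u*b-v*s+v*b*t = 1-u*b+v*(b*t-s) by ring,
    show 1 - u + s * (u - v) + (v - 1) * t = 1-u+s*(u-v)+t*(v-1) by ring]

lemma tQ_coeff (u v b s : ℂ) : (tQ u v b s).coeff 0 = (cQ u v b).eval s := by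
  simp only [tQ, cQ, Polynomial.mul_coeff_zero, Polynomial.coeff_add, Polynomial.coeff_C_zero,
    Polynomial.coeff_X_zero, Polynomial.eval_add, Polynomial.eval_mul, Polynomial.eval_C,
    Polynomial.eval_X, Polynomial.eval_sub]
  ring

lemma stage1 (m : ℕ) (u v b s z : ℂ) :
    (Polynomial.C z * (Polynomial.X * tQ u v b s ^ m)).coeff 1 =
      (Polynomial.C z * cQ u v b ^ m).eval s := by
  rw [Polynomial.coeff_C_mul, Polynomial.coeff_X_mul, pow_coeff0, tQ_coeff]
  simp

lemma row_40 {n : ℕ} {Φ : MultilinearMap ℂ (fun _ : Fin 4 => V (3*n+1)) (V 4)}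
    (hn : 12 ≤ n) (hΦ : IsClebschS n Φ) :
    cf 4 0 4 0 (Φ ![mV _ (3*n+1-3-2) 3 2, mV _ 1 (3*n) 0, mV _ 2 1 (3*n+1-2-1),
      mV _ (n+1) n n]) ≠ 0 := by
  intro hz
  have hz' := D_zero hΦ 0 4 0 _ _ _ _ _ _ _ _ _ _ _ _ (by omega) (by omega) (by omega) hz
  obtain ⟨t, rfl⟩ := Nat.exists_eq_add_of_le' hn
  set κ : ℂ := (((3*(t+12)+1).choose 2 * (3*(t+12)+1-2).choose 1 : ℕ) : ℂ) with hκ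
  have s1 : ∀ u v b, κ * cf 4 0 4 0 (Φ ![powV _ ![1,u,v], powV _ ![b,1,0],
      mV _ 2 1 (3*(t+12)+1-2-1), powV _ ![1,1,1]])
      = (-1)^(t+12) * u * (cQ u v b ^ (t+9+3)).coeff 2 := by
    intro u v b
    have := ex012 ((cf 4 0 4 0) ∘ₗ sl2 Φ (powV _ ![1,u,v]) (powV _ ![b,1,0]) (powV _ ![1,1,1]))
      (fun s => Polynomial.C ((-1)^(t+12) * u) * (Polynomial.X * tQ u v b s ^ (t+12)))
      (Polynomial.C ((-1)^(t+12) * u) * cQ u v b ^ (t+12)) ?_ 2 1 (by omega) ?_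
    · rw [LinearMap.comp_apply, sl2_apply, Polynomial.coeff_C_mul] at this
      exact this
    · intro s x
      rw [LinearMap.comp_apply, sl2_apply, hΦ.2, map_smul, Icov_BE, ← tQ_eval, neg_pow, cf_prod4]
      simp [Fin.sum_univ_three]
      ring
    · intro s
      exact stage1 _ _ _ _ _ _
  have s2 : ∀ u v, ((3*(t+12)+1 : ℕ) : ℂ) * (κ * cf 4 0 4 0 (Φ ![powV _ ![1,u,v],
      mV _ 1 (3*(t+12)) 0, mV _ 2 1 (3*(t+12)+1-2-1), powV _ ![1,1,1]]))
      = (-1)^(t+12) * (u * (cR (t+9) u v).coeff 1) := by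
    intro u v
    have := exB (κ • (cf 4 0 4 0) ∘ₗ sl1 Φ (powV _ ![1,u,v]) (mV _ 2 1 (3*(t+12)+1-2-1))
      (powV _ ![1,1,1])) (Polynomial.C ((-1)^(t+12) * u) * cR (t+9) u v) ?_ (by omega)
    · rw [LinearMap.smul_apply, LinearMap.comp_apply, sl1_apply, Polynomial.coeff_C_mul,
        mul_assoc] at this
      exact this
    · intro b
      rw [LinearMap.smul_apply, LinearMap.comp_apply, sl1_apply, smul_eq_mul, s1,
        Polynomial.eval_mul, Polynomial.eval_C, cR_eval]
  have key := uv_extract (((3*(t+12)+1 : ℕ) : ℂ) • κ • (cf 4 0 4 0) ∘ₗ sl0 Φ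
      (mV _ 1 (3*(t+12)) 0) (mV _ 2 1 (3*(t+12)+1-2-1)) (powV _ ![1,1,1])) (t+9) 6
      ((-1)^(t+12) * (1/2)) (fun i j => (((tb_c ((t+9 : ℕ) : ℂ)).getD i []).getD j 0)) ?_ 3 2
      (by omega) (by norm_num) (by norm_num)
  · rw [LinearMap.smul_apply, LinearMap.smul_apply, LinearMap.comp_apply, sl0_apply, hz',
      tb_c_val] at key
    have hpos : (13039488 + 8753760*t + 2531544*t^2 + 407546*t^3 + 39359*t^4 + 2277*t^5 + 73*t^6 + t^7 : ℕ) ≠ 0 := by positivity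
    have hpos' : ((13039488 + 8753760*t + 2531544*t^2 + 407546*t^3 + 39359*t^4 + 2277*t^5 + 73*t^6 + t^7 : ℕ) : ℂ) ≠ 0 := Nat.cast_ne_zero.2 hpos
    rw [smul_zero, smul_zero, mul_zero] at key
    refine (mul_ne_zero ?_ (mul_ne_zero (by norm_num) hpos')) key.symm
    exact mul_ne_zero (pow_ne_zero _ (by norm_num)) (by norm_num)
  · intro u v
    rw [LinearMap.smul_apply, LinearMap.smul_apply, LinearMap.comp_apply, sl0_apply, smul_eq_mul,
      smul_eq_mul, s2, cR_coeff]
    ring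

lemma row_04 {n : ℕ} {Φ : MultilinearMap ℂ (fun _ : Fin 4 => V (3*n+1)) (V 4)}
    (hn : 12 ≤ n) (hΦ : IsClebschS n Φ) :
    cf 4 0 0 4 (Φ ![mV _ (3*n+1-2-3) 2 3, mV _ 2 (3*n+1-2-1) 1, mV _ 1 0 (3*n),
      mV _ (n+1) n n]) ≠ 0 := by
  intro hz
  have hz' := D_zero hΦ 0 0 4 _ _ _ _ _ _ _ _ _ _ _ _ (by omega) (by omega) (by omega) hz
  obtain ⟨t, rfl⟩ := Nat.exists_eq_add_of_le' hn
  set κ : ℂ := (((3*(t+12)+1).choose 2 * (3*(t+12)+1-2).choose 1 : ℕ) : ℂ) with hκ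
  have s1 : ∀ u v c, κ * cf 4 0 0 4 (Φ ![powV _ ![1,u,v], mV _ 2 (3*(t+12)+1-2-1) 1,
      powV _ ![c,0,1], powV _ ![1,1,1]])
      = (-1)^(t+12) * v * (cQ v u c ^ (t+9+3)).coeff 2 := by
    intro u v c
    have := ex021 ((cf 4 0 0 4) ∘ₗ sl1 Φ (powV _ ![1,u,v]) (powV _ ![c,0,1]) (powV _ ![1,1,1]))
      (fun s => Polynomial.C ((-1)^(t+12) * v) * (Polynomial.X * tQ v u c s ^ (t+12)))
      (Polynomial.C ((-1)^(t+12) * v) * cQ v u c ^ (t+12)) ?_ 2 1 (by omega) ?_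
    · rw [LinearMap.comp_apply, sl1_apply, Polynomial.coeff_C_mul] at this
      exact this
    · intro s x
      rw [LinearMap.comp_apply, sl1_apply, hΦ.2, map_smul, Icov_CE, mul_comm x c, ← tQ_eval,
        neg_pow, cf_prod4]
      simp [Fin.sum_univ_three]
      ring
    · intro s
      exact stage1 _ _ _ _ _ _
  have s2 : ∀ u v, ((3*(t+12)+1 : ℕ) : ℂ) * (κ * cf 4 0 0 4 (Φ ![powV _ ![1,u,v],
      mV _ 2 (3*(t+12)+1-2-1) 1, mV _ 1 0 (3*(t+12)), powV _ ![1,1,1]]))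
      = (-1)^(t+12) * (v * (cR (t+9) v u).coeff 1) := by
    intro u v
    have := exC (κ • (cf 4 0 0 4) ∘ₗ sl2 Φ (powV _ ![1,u,v]) (mV _ 2 (3*(t+12)+1-2-1) 1)
      (powV _ ![1,1,1])) (Polynomial.C ((-1)^(t+12) * v) * cR (t+9) v u) ?_ (by omega)
    · rw [LinearMap.smul_apply, LinearMap.comp_apply, sl2_apply, Polynomial.coeff_C_mul,
        mul_assoc] at this
      exact this
    · intro b
      rw [LinearMap.smul_apply, LinearMap.comp_apply, sl2_apply, smul_eq_mul, s1,
        Polynomial.eval_mul, Polynomial.eval_C, cR_eval]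
  have key := uv_extract (((3*(t+12)+1 : ℕ) : ℂ) • κ • (cf 4 0 0 4) ∘ₗ sl0 Φ
      (mV _ 2 (3*(t+12)+1-2-1) 1) (mV _ 1 0 (3*(t+12))) (powV _ ![1,1,1])) (t+9) 6
      ((-1)^(t+12) * (1/2)) (fun i j => (((tb_c ((t+9 : ℕ) : ℂ)).getD j []).getD i 0)) ?_ 2 3
      (by omega) (by norm_num) (by norm_num)
  · rw [LinearMap.smul_apply, LinearMap.smul_apply, LinearMap.comp_apply, sl0_apply, hz',
      tb_c_val'] at key
    have hpos : (13039488 + 8753760*t + 2531544*t^2 + 407546*t^3 + 39359*t^4 + 2277*t^5 + 73*t^6 + t^7 : ℕ) ≠ 0 := by positivity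
    have hpos' : ((13039488 + 8753760*t + 2531544*t^2 + 407546*t^3 + 39359*t^4 + 2277*t^5 + 73*t^6 + t^7 : ℕ) : ℂ) ≠ 0 := Nat.cast_ne_zero.2 hpos
    rw [smul_zero, smul_zero, mul_zero] at key
    refine (mul_ne_zero ?_ (mul_ne_zero (by norm_num) hpos')) key.symm
    exact mul_ne_zero (pow_ne_zero _ (by norm_num)) (by norm_num)
  · intro u v
    rw [LinearMap.smul_apply, LinearMap.smul_apply, LinearMap.comp_apply, sl0_apply, smul_eq_mul,
      smul_eq_mul, s2, cR_coeff, Finset.sum_comm]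
    have : ∀ i j : ℕ, (((tb_c ((t+9 : ℕ) : ℂ)).getD j []).getD i 0) * v ^ j * u ^ i =
      (((tb_c ((t+9 : ℕ) : ℂ)).getD j []).getD i 0) * u ^ i * v ^ j := fun i j => by ring
    simp only [this]
    ring

/-! ### Final assembly -/

def gx0 (n : ℕ) : Fin 5 → ℕ := ![1, 1, n+1, 2, 2]
def gx1 (n : ℕ) : Fin 5 → ℕ := ![3*n, 0, n, 1, 3*n+1-2-1]
def gx2 (n : ℕ) : Fin 5 → ℕ := ![0, 3*n, n, 3*n+1-2-1, 1]
def gG (n : ℕ) (x : Fin 5) : V (3*n+1) := mV _ (gx0 n x) (gx1 n x) (gx2 n x)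
def gg (n : ℕ) : V (3*n+1) := ∑ x, gG n x

lemma gg_expand {n : ℕ} (Φ : MultilinearMap ℂ (fun _ : Fin 4 => V (3*n+1)) (V 4))
    (h : V (3*n+1)) :
    Φ ![h, gg n, gg n, gg n] = ∑ x, ∑ y, ∑ z, Φ ![h, gG n x, gG n y, gG n z] := by
  rw [← sl1_apply]
  conv_lhs => arg 2; rw [gg]
  rw [map_sum]
  refine Finset.sum_congr rfl fun x _ => ?_
  rw [sl1_apply, ← sl2_apply]
  conv_lhs => arg 2; rw [gg]
  rw [map_sum]
  refine Finset.sum_congr rfl fun y _ => ?_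
  rw [sl2_apply, ← sl3_apply]
  conv_lhs => arg 2; rw [gg]
  rw [map_sum]
  refine Finset.sum_congr rfl fun z _ => ?_
  rw [sl3_apply]

lemma mem_of_cf (W : Submodule ℂ (V 4)) (f : V 4)
    (h : ∀ i j k, i + j + k = 4 → cf 4 i j k f ≠ 0 → mV 4 i j k ∈ W) : f ∈ W := by
  have key : f = ∑ i ∈ Finset.range 5, ∑ j ∈ Finset.range 5,
      (if i + j ≤ 4 then cf 4 i j (4-i-j) f • mV 4 i j (4-i-j) else 0) := by
    rw [← sub_eq_zero]
    apply cf_ext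
    intro i j k hijk
    rw [map_sub, map_sum, sub_eq_zero]
    rw [Finset.sum_eq_single i]
    · rw [map_sum, Finset.sum_eq_single j]
      · rw [if_pos (by omega), map_smul, cf_mV (by omega), if_pos (by omega)]
        rw [show 4 - i - j = k by omega]; simp
      · intro b _ hb
        split_ifs with hle
        · rw [map_smul, cf_mV (by omega), if_neg (by omega), smul_zero]
        · simp
      · intro hj; exact absurd (Finset.mem_range.2 (by omega)) hj
    · intro a _ ha
      rw [map_sum]
      refine Finset.sum_eq_zero fun b _ => ?_
      split_ifs with hle
      · rw [map_smul, cf_mV (by omega), if_neg (by omega), smul_zero]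
      · simp
    · intro hj; exact absurd (Finset.mem_range.2 (by omega)) hj
  rw [key]
  refine W.sum_mem fun i _ => W.sum_mem fun j _ => ?_
  split_ifs with hle
  · by_cases h0 : cf 4 i j (4-i-j) f = 0
    · rw [h0, zero_smul]; exact W.zero_mem
    · exact W.smul_mem _ (h i j _ (by omega) h0)
  · exact W.zero_mem

lemma Phi_sym {n : ℕ} {Φ : MultilinearMap ℂ (fun _ : Fin 4 => V (3*n+1)) (V 4)}
    (hΦ : IsClebschS n Φ) (a b c e : V (3*n+1)) :
    Φ ![a,c,b,e] = Φ ![a,b,c,e] ∧ Φ ![a,b,e,c] = Φ ![a,b,c,e] := by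
  constructor
  · rw [← hΦ.1 ![a,b,c,e] (Equiv.swap 1 2)]
    congr 1; ext i : 1; fin_cases i <;> rfl
  · rw [← hΦ.1 ![a,b,c,e] (Equiv.swap 2 3)]
    congr 1; ext i : 1; fin_cases i <;> rfl

def isP (p q r x y z : Fin 5) : Prop :=
  (x = p ∧ y = q ∧ z = r) ∨ (x = p ∧ y = r ∧ z = q) ∨ (x = q ∧ y = p ∧ z = r) ∨
  (x = q ∧ y = r ∧ z = p) ∨ (x = r ∧ y = p ∧ z = q) ∨ (x = r ∧ y = q ∧ z = p)

instance (p q r x y z : Fin 5) : Decidable (isP p q r x y z) := by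
  unfold isP; infer_instance

lemma isP_eq {n : ℕ} {Φ : MultilinearMap ℂ (fun _ : Fin 4 => V (3*n+1)) (V 4)}
    (hΦ : IsClebschS n Φ) (a : V (3*n+1)) (p q r x y z : Fin 5) (h : isP p q r x y z) :
    Φ ![a, gG n x, gG n y, gG n z] = Φ ![a, gG n p, gG n q, gG n r] := by
  have s1 := fun b c e => (Phi_sym hΦ a b c e).1
  have s2 := fun b c e => (Phi_sym hΦ a b c e).2
  rcases h with ⟨rfl, rfl, rfl⟩ | ⟨rfl, rfl, rfl⟩ | ⟨rfl, rfl, rfl⟩ | ⟨rfl, rfl, rfl⟩ |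
    ⟨rfl, rfl, rfl⟩ | ⟨rfl, rfl, rfl⟩
  · rfl
  · rw [s2]
  · rw [s1]
  · rw [s1 (gG n x) (gG n z) (gG n y), s2 (gG n x) (gG n y) (gG n z)]
  · rw [s2 (gG n y) (gG n x) (gG n z), s1 (gG n x) (gG n y) (gG n z)]
  · rw [s1, s2, s1]

lemma step {n : ℕ} {Φ : MultilinearMap ℂ (fun _ : Fin 4 => V (3*n+1)) (V 4)}
    (hΦ : IsClebschS n Φ) (W : Submodule ℂ (V 4)) (a0 a1 a2 : ℕ) (p q r : Fin 5)
    (hW : Φ ![mV _ a0 a1 a2, gg n, gg n, gg n] ∈ W) (i j k : ℕ)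
    (hm : a0 + gx0 n p + gx0 n q + gx0 n r = 4*n+i ∧ a1 + gx1 n p + gx1 n q + gx1 n r = 4*n+j ∧
      a2 + gx2 n p + gx2 n q + gx2 n r = 4*n+k) (hs : i + j + k = 4)
    (hne : cf 4 i j k (Φ ![mV _ a0 a1 a2, gG n p, gG n q, gG n r]) ≠ 0)
    (ho : ∀ x y z : Fin 5, ¬ isP p q r x y z → ∀ u v w : ℕ, u + v + w = 4 →
      a0 + gx0 n x + gx0 n y + gx0 n z = 4*n+u → a1 + gx1 n x + gx1 n y + gx1 n z = 4*n+v →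
      a2 + gx2 n x + gx2 n y + gx2 n z = 4*n+w → mV 4 u v w ∈ W) :
    mV 4 i j k ∈ W := by
  set T := Φ ![mV _ a0 a1 a2, gG n p, gG n q, gG n r] with hT
  have hoth : ∀ x y z : Fin 5, ¬ isP p q r x y z →
      Φ ![mV _ a0 a1 a2, gG n x, gG n y, gG n z] ∈ W := by
    intro x y z hx
    apply mem_of_cf
    intro u v w huvw hc
    by_contra hcon
    apply hc
    apply weight hΦ
    rintro ⟨h1, h2, h3⟩
    exact hcon (ho x y z hx u v w huvw h1 h2 h3)
  rw [gg_expand] at hW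
  have e : ∑ x, ∑ y, ∑ z, Φ ![mV _ a0 a1 a2, gG n x, gG n y, gG n z]
      = (∑ x, ∑ y, ∑ z, if isP p q r x y z then 1 else 0 : ℕ) • T
      + ∑ x, ∑ y, ∑ z, if isP p q r x y z then 0 else
        Φ ![mV _ a0 a1 a2, gG n x, gG n y, gG n z] := by
    simp only [Finset.sum_smul, ← Finset.sum_add_distrib]
    refine Finset.sum_congr rfl fun x _ => Finset.sum_congr rfl fun y _ =>
      Finset.sum_congr rfl fun z _ => ?_
    split_ifs with hx
    · rw [isP_eq hΦ _ p q r x y z hx]; simp [hT]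
    · simp
  rw [e] at hW
  have hr : (∑ x, ∑ y, ∑ z, if isP p q r x y z then 0 else
        Φ ![mV _ a0 a1 a2, gG n x, gG n y, gG n z]) ∈ W := by
    refine W.sum_mem fun x _ => W.sum_mem fun y _ => W.sum_mem fun z _ => ?_
    split_ifs with hx
    · exact W.zero_mem
    · exact hoth x y z hx
  have h1 := (W.add_mem_iff_left hr).1 hW
  have hcount : (∑ x, ∑ y, ∑ z, if isP p q r x y z then 1 else 0 : ℕ) ≠ 0 := by
    intro h0
    have := Finset.sum_eq_zero_iff.1 h0 p (Finset.mem_univ _)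
    have := Finset.sum_eq_zero_iff.1 this q (Finset.mem_univ _)
    have := Finset.sum_eq_zero_iff.1 this r (Finset.mem_univ _)
    rw [if_pos (show isP p q r p q r from Or.inl ⟨rfl, rfl, rfl⟩)] at this
    exact one_ne_zero this
  rw [← Nat.cast_smul_eq_nsmul ℂ] at h1
  have hTW : T ∈ W := (W.smul_mem_iff (by exact_mod_cast hcount)).1 h1
  have hTe : T = cf 4 i j k T • mV 4 i j k := by
    rw [← sub_eq_zero]
    apply cf_ext
    intro u v w huvw
    rw [map_sub, map_smul, cf_mV hs]
    split_ifs with hu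
    · obtain ⟨rfl, rfl, rfl⟩ := hu; simp
    · have : cf 4 u v w T = 0 := by
        apply weight hΦ
        rintro ⟨g1, g2, g3⟩
        obtain ⟨h1, h2, h3⟩ := hm
        omega
      rw [this]; simp
  rw [hTe] at hTW
  exact (W.smul_mem_iff hne).1 hTW

lemma memLS_mV (n : ℕ) (a0 a1 a2 : ℕ) (h : a0 + a1 + a2 = 3*n+1) (h' : 2*n+3 ≤ a0) :
    memLS n (mV _ a0 a1 a2) := by
  unfold memLS
  rw [mV_coe h, mx, mul_assoc]
  exact Dvd.dvd.mul_right (pow_dvd_pow _ h') _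

lemma tri_lem (n : ℕ) (hn : 12 ≤ n) (x y z : Fin 5) (a1 a2 u v w : ℕ)
    (h1 : a1 ≤ 4) (h2 : a2 ≤ 4)
    (huvw : u + v + w = 4)
    (e1 : a1 + gx1 n x + gx1 n y + gx1 n z = 4*n+v)
    (e2 : a2 + gx2 n x + gx2 n y + gx2 n z = 4*n+w) :
    (isP 0 1 2 x y z ∧ v = a1 ∧ w = a2) ∨ (isP 4 1 2 x y z ∧ v + 2 = a1 ∧ w = a2 + 1) ∨
    (isP 0 3 2 x y z ∧ v = a1 + 1 ∧ w + 2 = a2) ∨ (isP 2 3 4 x y z ∧ v + 1 = a1 ∧ w + 1 = a2) := by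
  have g10 : gx1 n 0 = 3*n := rfl
  have g11 : gx1 n 1 = 0 := rfl
  have g12 : gx1 n 2 = n := rfl
  have g13 : gx1 n 3 = 1 := rfl
  have g14 : gx1 n 4 = 3*n+1-2-1 := rfl
  have g20 : gx2 n 0 = 0 := rfl
  have g21 : gx2 n 1 = 3*n := rfl
  have g22 : gx2 n 2 = n := rfl
  have g23 : gx2 n 3 = 3*n+1-2-1 := rfl
  have g24 : gx2 n 4 = 1 := rfl
  by_cases p1 : isP 0 1 2 x y z
  · left; refine ⟨p1, ?_⟩
    rcases p1 with ⟨rfl, rfl, rfl⟩ | ⟨rfl, rfl, rfl⟩ | ⟨rfl, rfl, rfl⟩ | ⟨rfl, rfl, rfl⟩ |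
      ⟨rfl, rfl, rfl⟩ | ⟨rfl, rfl, rfl⟩ <;> omega
  by_cases p2 : isP 4 1 2 x y z
  · right; left; refine ⟨p2, ?_⟩
    rcases p2 with ⟨rfl, rfl, rfl⟩ | ⟨rfl, rfl, rfl⟩ | ⟨rfl, rfl, rfl⟩ | ⟨rfl, rfl, rfl⟩ |
      ⟨rfl, rfl, rfl⟩ | ⟨rfl, rfl, rfl⟩ <;> omega
  by_cases p3 : isP 0 3 2 x y z
  · right; right; left; refine ⟨p3, ?_⟩
    rcases p3 with ⟨rfl, rfl, rfl⟩ | ⟨rfl, rfl, rfl⟩ | ⟨rfl, rfl, rfl⟩ | ⟨rfl, rfl, rfl⟩ |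
      ⟨rfl, rfl, rfl⟩ | ⟨rfl, rfl, rfl⟩ <;> omega
  by_cases p4 : isP 2 3 4 x y z
  · right; right; right; refine ⟨p4, ?_⟩
    rcases p4 with ⟨rfl, rfl, rfl⟩ | ⟨rfl, rfl, rfl⟩ | ⟨rfl, rfl, rfl⟩ | ⟨rfl, rfl, rfl⟩ |
      ⟨rfl, rfl, rfl⟩ | ⟨rfl, rfl, rfl⟩ <;> omega
  exfalso
  have all : ∀ x : Fin 5, x = 0 ∨ x = 1 ∨ x = 2 ∨ x = 3 ∨ x = 4 := by decide
  rcases all x with rfl | rfl | rfl | rfl | rfl <;>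
  rcases all y with rfl | rfl | rfl | rfl | rfl <;>
  rcases all z with rfl | rfl | rfl | rfl | rfl <;>
  first
  | omega
  | exact p1 (by decide)
  | exact p2 (by decide)
  | exact p3 (by decide)
  | exact p4 (by decide)

section fin
variable {n : ℕ} {Φ : MultilinearMap ℂ (fun _ : Fin 4 => V (3*n+1)) (V 4)}

lemma row_all (hn : 12 ≤ n) (hΦ : IsClebschS n Φ) (q r : ℕ) (hqr : q + r ≤ 4)
    (h4 : q ≠ 4) (h4' : r ≠ 4) :
    cf 4 (4-q-r) q r (Φ ![mV _ (3*n+1-q-r) q r, gG n 0, gG n 1, gG n 2]) ≠ 0 := by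
  have hq : q ≤ 3 := by omega
  have hr : r ≤ 3 := by omega
  interval_cases q <;> interval_cases r
  · exact row_00 hn hΦ
  · exact row_01 hn hΦ
  · exact row_02 hn hΦ
  · exact row_03 hn hΦ
  · exact row_10 hn hΦ
  · exact row_11 hn hΦ
  · exact row_12 hn hΦ
  · exact row_13 hn hΦ
  · exact row_20 hn hΦ
  · exact row_21 hn hΦ
  · exact row_22 hn hΦ
  · omega
  · exact row_30 hn hΦ
  · exact row_31 hn hΦ
  · omega
  · omega

lemma main_nc (hn : 12 ≤ n) (hΦ : IsClebschS n Φ) (W : Submodule ℂ (V 4))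
    (hW : ∀ h, memLS n h → Φ ![h, gg n, gg n, gg n] ∈ W) (s : ℕ) :
    ∀ q r, q + r = s → q + r ≤ 4 → q ≠ 4 → r ≠ 4 → mV 4 (4-q-r) q r ∈ W := by
  induction s using Nat.strong_induction_on with
  | _ s ih =>
    intro q r hs hqr h4 h4'
    refine step hΦ W (3*n+1-q-r) q r 0 1 2 (hW _ (memLS_mV _ _ _ _ (by omega) (by omega)))
      (4-q-r) q r ?_ (by omega) (row_all hn hΦ q r hqr h4 h4') ?_
    · simp [gx0, gx1, gx2]; omega
    · intro x y z hx u v w huvw e0 e1 e2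
      have : v + w < q + r := by
        rcases tri_lem n hn x y z q r u v w (by omega) (by omega) huvw e1 e2 with
          ⟨t, _⟩ | ⟨t, _⟩ | ⟨t, _⟩ | ⟨t, _⟩ <;> first | omega | exact absurd t hx
      have h := ih (v+w) (by omega) v w rfl (by omega) (by omega) (by omega)
      rwa [show 4 - v - w = u by omega] at h

lemma main_40 (hn : 12 ≤ n) (hΦ : IsClebschS n Φ) (W : Submodule ℂ (V 4))
    (hW : ∀ h, memLS n h → Φ ![h, gg n, gg n, gg n] ∈ W) : mV 4 0 4 0 ∈ W := by
  refine step hΦ W (3*n+1-3-2) 3 2 0 3 2 (hW _ (memLS_mV _ _ _ _ (by omega) (by omega)))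
      0 4 0 ?_ (by omega) (row_40 hn hΦ) ?_
  · simp [gx0, gx1, gx2]; omega
  · intro x y z hx u v w huvw e0 e1 e2
    have : v ≠ 4 ∧ w ≠ 4 := by
      rcases tri_lem n hn x y z 3 2 u v w (by omega) (by omega) huvw e1 e2 with
        ⟨t, _⟩ | ⟨t, _⟩ | ⟨t, _⟩ | ⟨t, _⟩ <;> first | omega | exact absurd t hx
    have h := main_nc hn hΦ W hW (v+w) v w rfl (by omega) this.1 this.2
    rwa [show 4 - v - w = u by omega] at h

lemma main_04 (hn : 12 ≤ n) (hΦ : IsClebschS n Φ) (W : Submodule ℂ (V 4))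
    (hW : ∀ h, memLS n h → Φ ![h, gg n, gg n, gg n] ∈ W) : mV 4 0 0 4 ∈ W := by
  refine step hΦ W (3*n+1-2-3) 2 3 4 1 2 (hW _ (memLS_mV _ _ _ _ (by omega) (by omega)))
      0 0 4 ?_ (by omega) (row_04 hn hΦ) ?_
  · simp [gx0, gx1, gx2]; omega
  · intro x y z hx u v w huvw e0 e1 e2
    have : v ≠ 4 ∧ w ≠ 4 := by
      rcases tri_lem n hn x y z 2 3 u v w (by omega) (by omega) huvw e1 e2 with
        ⟨t, _⟩ | ⟨t, _⟩ | ⟨t, _⟩ | ⟨t, _⟩ <;> first | omega | exact absurd t hx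
    have h := main_nc hn hΦ W hW (v+w) v w rfl (by omega) this.1 this.2
    rwa [show 4 - v - w = u by omega] at h

end fin

theorem stmt16 (n : ℕ) (hn : 12 ≤ n)
    (Φ : MultilinearMap ℂ (fun _ : Fin 4 => V (3*n+1)) (V 4)) (hΦ : IsClebschS n Φ) :
    ∃ g : V (3*n+1),
      Submodule.span ℂ
        (((fun h => Φ ![h, g, g, g]) '' {h : V (3*n+1) | memLS n h}) ∪ {Φ ![g, g, g, g]})
        = ⊤ := by
  refine ⟨gg n, ?_⟩
  set W := Submodule.span ℂ (((fun h => Φ ![h, gg n, gg n, gg n]) ''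
    {h : V (3*n+1) | memLS n h}) ∪ {Φ ![gg n, gg n, gg n, gg n]}) with hWd
  have hW : ∀ h, memLS n h → Φ ![h, gg n, gg n, gg n] ∈ W := fun h hh =>
    Submodule.subset_span (Or.inl ⟨h, hh, rfl⟩)
  apply mV_span
  intro i j k
  by_cases hd : i + j + k = 4
  · by_cases h1 : j = 4
    · obtain ⟨rfl, rfl, rfl⟩ : i = 0 ∧ j = 4 ∧ k = 0 := by omega
      exact main_40 hn hΦ W hW
    · by_cases h2 : k = 4
      · obtain ⟨rfl, rfl, rfl⟩ : i = 0 ∧ j = 0 ∧ k = 4 := by omega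
        exact main_04 hn hΦ W hW
      · have h := main_nc hn hΦ W hW (j+k) j k rfl (by omega) h1 h2
        rwa [show 4 - j - k = i by omega] at h
  · rw [mV_zero hd]; exact W.zero_mem
end
end
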